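/- arXiv:2112.10169 — 2 statements merged into one kernel-verified Lean document; each statement's English description precedes it below -/
import Mathlib

section
/- Let n ∈ ℕ, let K be a singular kernel function satisfying the monotonicity condition (M), let J be an upper semicontinuous n-field function, and let r₁,…,rₙ > 0. Then M(S) = m(S), and there exists a node system w ∈ S̄, belonging to the regularity set Y, which is an equioscillation point and satisfies m̲(w) = m(S) = M(S) = m̄(w). Moreover the Sandwich Property holds: for every x ∈ S, m̲(x) ≤ M(S) = m(S) ≤ m̄(x); in particular M(S) = m(S) is the unique equioscillation value, i.e., every equioscillation point has common interval-maximum value M(S). If in addition K is strictly monotone (SM), then w is the unique equioscillation point. -/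
open Set Filter

noncomputable section

/-- A kernel function: `ℝ ∪ {−∞}`-valued (modeled as `EReal`, never `⊤`),
finite and concave on `(-1,0)` and `(0,1)`, extended continuously to `[-1,1]`. -/
structure IsKernel (K : ℝ → EReal) : Prop where
  ne_top : ∀ t, K t ≠ ⊤
  finite_off_zero : ∀ t ∈ Ioo (-1:ℝ) 1, t ≠ 0 → K t ≠ ⊥
  concave_neg : ConcaveOn ℝ (Ioo (-1:ℝ) 0) (fun t => (K t).toReal)
  concave_pos : ConcaveOn ℝ (Ioo (0:ℝ) 1) (fun t => (K t).toReal)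
  lim_zero_left : Tendsto K (nhdsWithin 0 (Iio 0)) (nhds (K 0))
  lim_zero_right : Tendsto K (nhdsWithin 0 (Ioi 0)) (nhds (K 0))
  lim_neg_one : Tendsto K (nhdsWithin (-1) (Ioi (-1))) (nhds (K (-1)))
  lim_one : Tendsto K (nhdsWithin 1 (Iio 1)) (nhds (K 1))

/-- Singularity condition `(∞)`: `K(0) = −∞`. -/
def SingularKernel (K : ℝ → EReal) : Prop := K 0 = ⊥

/-- Monotonicity condition (M). -/
def MonotoneKernel (K : ℝ → EReal) : Prop :=
  AntitoneOn K (Ioo (-1:ℝ) 0) ∧ MonotoneOn K (Ioo (0:ℝ) 1)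

/-- Strict monotonicity condition (SM). -/
def StrictMonotoneKernel (K : ℝ → EReal) : Prop :=
  StrictAntiOn K (Ico (-1:ℝ) 0) ∧ StrictMonoOn K (Ioc (0:ℝ) 1)

/-- Strict concavity of a kernel function. -/
def StrictConcaveKernel (K : ℝ → EReal) : Prop :=
  StrictConcaveOn ℝ (Ioo (-1:ℝ) 0) (fun t => (K t).toReal) ∧
  StrictConcaveOn ℝ (Ioo (0:ℝ) 1) (fun t => (K t).toReal)

/-- An `n`-field function: bounded above, never `+∞`, finite on a set of weighted
cardinality exceeding `n` (interior points of `[0,1]` count `1`, the endpoints `1/2`). -/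
def IsFieldFn (n : ℕ) (J : ℝ → EReal) : Prop :=
  (∀ t, J t ≠ ⊤) ∧ (∃ M : ℝ, ∀ t ∈ Icc (0:ℝ) 1, J t ≤ (M : EReal)) ∧
  ∃ T : Finset ℝ, (T : Set ℝ) ⊆ Icc (0:ℝ) 1 ∧ (∀ t ∈ T, J t ≠ ⊥) ∧
    (n : ℝ) < ∑ t ∈ T, (if t = 0 ∨ t = 1 then (1/2 : ℝ) else 1)

/-- The closed simplex `S̄`. -/
def closedSimplex (n : ℕ) : Set (Fin n → ℝ) :=
  {y | Monotone y ∧ ∀ j, y j ∈ Icc (0:ℝ) 1}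

/-- The open simplex `S`. -/
def openSimplex (n : ℕ) : Set (Fin n → ℝ) :=
  {y | StrictMono y ∧ ∀ j, y j ∈ Ioo (0:ℝ) 1}

/-- Extended nodes: `y₀ = 0`, `y_{n+1} = 1`. -/
def extNode {n : ℕ} (y : Fin n → ℝ) (j : Fin (n + 2)) : ℝ :=
  if _h0 : (j : ℕ) = 0 then 0
  else if _hn : (j : ℕ) ≤ n then y ⟨(j : ℕ) - 1, by omega⟩
  else 1

/-- The interval `I_j(y) = [y_j, y_{j+1}]`, `j = 0, …, n`. -/
def nodeInterval {n : ℕ} (y : Fin n → ℝ) (j : Fin (n + 1)) : Set ℝ :=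
  Icc (extNode y j.castSucc) (extNode y j.succ)

/-- The sum of translates function `F(y,t) = J(t) + ∑ⱼ rⱼ K(t - yⱼ)`. -/
def sumTrans {n : ℕ} (r : Fin n → ℝ) (K J : ℝ → EReal) (y : Fin n → ℝ) (t : ℝ) : EReal :=
  J t + ∑ j, (r j : EReal) * K (t - y j)

/-- The interval maximum `m_j(y) = sup_{t ∈ I_j(y)} F(y,t)`. -/
def mj {n : ℕ} (r : Fin n → ℝ) (K J : ℝ → EReal) (j : Fin (n + 1)) (y : Fin n → ℝ) : EReal :=
  sSup (sumTrans r K J y '' nodeInterval y j)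

/-- `m̄(y) = max_j m_j(y)`. -/
def mbar {n : ℕ} (r : Fin n → ℝ) (K J : ℝ → EReal) (y : Fin n → ℝ) : EReal :=
  ⨆ j, mj r K J j y

/-- `m̲(y) = min_j m_j(y)`. -/
def munder {n : ℕ} (r : Fin n → ℝ) (K J : ℝ → EReal) (y : Fin n → ℝ) : EReal :=
  ⨅ j, mj r K J j y

/-- The regularity set `Y`. -/
def regSet {n : ℕ} (r : Fin n → ℝ) (K J : ℝ → EReal) : Set (Fin n → ℝ) :=
  {y ∈ openSimplex n | ∀ j, mj r K J j y ≠ ⊥}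

/-- Equioscillation: all interval maxima agree. -/
def Equioscillation {n : ℕ} (r : Fin n → ℝ) (K J : ℝ → EReal) (y : Fin n → ℝ) : Prop :=
  ∀ i j : Fin (n + 1), mj r K J i y = mj r K J j y

/-- A singular kernel, with values `k` off zero, that is concave and monotone on both sides. -/
structure RegKernel (K : ℝ → EReal) (k : ℝ → ℝ) : Prop where
  zero : K 0 = ⊥
  coe : ∀ t ∈ Icc (-1:ℝ) 1, t ≠ 0 → K t = k t
  cont : ContinuousOn K (Icc (-1) 1)
  concave_neg : ConcaveOn ℝ (Ioo (-1:ℝ) 0) k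
  concave_pos : ConcaveOn ℝ (Ioo (0:ℝ) 1) k
  anti : AntitoneOn k (Ioo (-1:ℝ) 0)
  mono : MonotoneOn k (Ioo (0:ℝ) 1)

/-- A regular kernel that is strictly monotone on both sides. -/
structure StrictRegKernel (K : ℝ → EReal) (k : ℝ → ℝ) : Prop extends RegKernel K k where
  strictAnti : StrictAntiOn k (Ioo (-1:ℝ) 0)
  strictMono : StrictMonoOn k (Ioo (0:ℝ) 1)

lemma RegKernel.ne_top {K : ℝ → EReal} {k : ℝ → ℝ} (h : RegKernel K k) {t : ℝ}
    (ht : t ∈ Icc (-1:ℝ) 1) : K t ≠ ⊤ := by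
  rcases eq_or_ne t 0 with rfl | h0
  · simp [h.zero]
  · simp [h.coe t ht h0]

/-- The four point inequality for concave functions. -/
lemma ConcaveOn.four_point {s : Set ℝ} {k : ℝ → ℝ} (h : ConcaveOn ℝ s k) {a b c d : ℝ}
    (ha : a ∈ s) (hd : d ∈ s) (hab : a ≤ b) (hac : a ≤ c) (hsum : a + d = b + c) :
    k a + k d ≤ k b + k c := by
  rcases (show a ≤ d by linarith).eq_or_lt with had | had
  · have hb : b = a := by linarith
    have hc : c = a := by linarith
    simp [hb, hc, ← had]
  · have hda : d - a ≠ 0 := by linarith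
    have hda' : 0 < d - a := by linarith
    have e1 := h.2 ha hd (
      div_nonneg (by linarith) hda'.le) (div_nonneg (by linarith) hda'.le)
      (show (d - b) / (d - a) + (b - a) / (d - a) = 1 by field_simp; ring)
    have e2 := h.2 ha hd (
      div_nonneg (by linarith) hda'.le) (div_nonneg (by linarith) hda'.le)
      (show (d - c) / (d - a) + (c - a) / (d - a) = 1 by field_simp; ring)
    have hb : ((d - b) / (d - a)) • a + ((b - a) / (d - a)) • d = b := by
      simp only [smul_eq_mul]; field_simp; ring
    have hc : ((d - c) / (d - a)) • a + ((c - a) / (d - a)) • d = c := by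
      simp only [smul_eq_mul]; field_simp; ring
    rw [hb] at e1
    rw [hc] at e2
    simp only [smul_eq_mul] at e1 e2
    have h1 : (d - b) / (d - a) + (d - c) / (d - a) = 1 := by
      field_simp; linarith
    have h2 : (b - a) / (d - a) + (c - a) / (d - a) = 1 := by
      field_simp; linarith
    calc k a + k d = ((d - b) / (d - a) + (d - c) / (d - a)) * k a +
          ((b - a) / (d - a) + (c - a) / (d - a)) * k d := by rw [h1, h2]; ring
      _ ≤ _ := by linarith

/-- Secant slopes of a strictly concave function over successive intervals decrease. -/
lemma StrictConcaveOn.slope_lt {s : Set ℝ} {k : ℝ → ℝ} (h : StrictConcaveOn ℝ s k)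
    {a b c d : ℝ} (ha : a ∈ s) (hd : d ∈ s) (hab : a < b) (hbc : b ≤ c) (hcd : c < d) :
    (k d - k c) / (d - c) < (k b - k a) / (b - a) := by
  have hs := h.1.ordConnected
  have hb : b ∈ s := hs.out ha hd ⟨hab.le, by linarith⟩
  have hc : c ∈ s := hs.out ha hd ⟨by linarith, hcd.le⟩
  rcases hbc.eq_or_lt with rfl | hbc
  · exact h.slope_anti_adjacent ha hd hab hcd
  · exact (h.slope_anti_adjacent hb hd hbc hcd).trans (h.slope_anti_adjacent ha hc hab hbc)

/-- The extended nodes indexed by natural numbers. -/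
def natNode {n : ℕ} (y : Fin n → ℝ) (j : ℕ) : ℝ :=
  if j = 0 then 0 else if h : j - 1 < n then y ⟨j - 1, h⟩ else 1

lemma extNode_eq {n : ℕ} (y : Fin n → ℝ) (j : Fin (n + 2)) : extNode y j = natNode y j := by
  unfold extNode natNode
  rcases j with ⟨j, hj⟩
  dsimp only
  split_ifs <;> first | rfl | omega

lemma mem_nodeInterval {n : ℕ} (y : Fin n → ℝ) (j : Fin (n + 1)) (t : ℝ) :
    t ∈ nodeInterval y j ↔ natNode y j ≤ t ∧ t ≤ natNode y (j + 1) := by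
  simp [nodeInterval, extNode_eq]

@[simp] lemma natNode_zero {n : ℕ} (y : Fin n → ℝ) : natNode y 0 = 0 := by simp [natNode]

@[simp] lemma natNode_last {n : ℕ} (y : Fin n → ℝ) : natNode y (n + 1) = 1 := by simp [natNode]

@[simp] lemma natNode_succ {n : ℕ} (y : Fin n → ℝ) (i : Fin n) : natNode y (i + 1) = y i := by
  simp [natNode]

lemma natNode_eq {n : ℕ} (y : Fin n → ℝ) {j : ℕ} (h0 : 1 ≤ j) (hj : j ≤ n) :
    ∃ i : Fin n, (i : ℕ) + 1 = j ∧ natNode y j = y i :=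
  ⟨⟨j - 1, by omega⟩, by simp; omega, by simp [natNode, show j ≠ 0 by omega, show j - 1 < n by omega]⟩

lemma natNode_mem {n : ℕ} {y : Fin n → ℝ} (hy : ∀ i, y i ∈ Icc (0:ℝ) 1) (j : ℕ) :
    natNode y j ∈ Icc (0:ℝ) 1 := by
  unfold natNode
  split_ifs
  · simp
  · exact hy _
  · simp

lemma natNode_le_succ {n : ℕ} {y : Fin n → ℝ} (hy : y ∈ closedSimplex n) (j : ℕ) :
    natNode y j ≤ natNode y (j + 1) := by
  rcases Nat.eq_zero_or_pos j with rfl | h0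
  · rw [natNode_zero]; exact (natNode_mem hy.2 _).1
  rcases lt_or_ge j n with hj | hj
  · have e1 := natNode_succ y ⟨j - 1, by omega⟩
    have e2 := natNode_succ y ⟨j, hj⟩
    simp only [show j - 1 + 1 = j by omega] at e1
    simp only at e2
    rw [e1, e2]
    exact hy.1 (by simp [Fin.le_def])
  · have : natNode y (j + 1) = 1 := by simp [natNode]; omega
    rw [this]; exact (natNode_mem hy.2 _).2

lemma natNode_monotone {n : ℕ} {y : Fin n → ℝ} (hy : y ∈ closedSimplex n) :
    Monotone (natNode y) := monotone_nat_of_le_succ (natNode_le_succ hy)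

lemma openSimplex_subset_closedSimplex {n : ℕ} : openSimplex n ⊆ closedSimplex n :=
  fun _ hy => ⟨hy.1.monotone, fun j => Ioo_subset_Icc_self (hy.2 j)⟩

/-- The node intervals cover `[0, 1]`. -/
lemma exists_mem_nodeInterval {n : ℕ} (y : Fin n → ℝ) {t : ℝ} (ht : t ∈ Icc (0:ℝ) 1) :
    ∃ j, t ∈ nodeInterval y j := by
  classical
  have hex : ∃ j, t ≤ natNode y (j + 1) := ⟨n, by simpa using ht.2⟩
  have hle : Nat.find hex ≤ n := Nat.find_min' hex (by simpa using ht.2)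
  refine ⟨⟨Nat.find hex, by omega⟩, (mem_nodeInterval _ _ _).2 ⟨?_, Nat.find_spec hex⟩⟩
  dsimp only
  rcases Nat.eq_zero_or_pos (Nat.find hex) with h0 | h0
  · rw [h0]; simpa using ht.1
  · have := Nat.find_min hex (m := Nat.find hex - 1) (by omega)
    rw [show Nat.find hex - 1 + 1 = Nat.find hex by omega] at this
    exact (not_le.1 this).le

lemma nodeInterval_subset {n : ℕ} {y : Fin n → ℝ} (hy : ∀ i, y i ∈ Icc (0:ℝ) 1)
    (j : Fin (n + 1)) : nodeInterval y j ⊆ Icc 0 1 := fun t ht => by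
  rw [mem_nodeInterval] at ht
  exact ⟨(natNode_mem hy _).1.trans ht.1, ht.2.trans (natNode_mem hy _).2⟩

lemma closedSimplex_isCompact (n : ℕ) : IsCompact (closedSimplex n) := by
  have h : closedSimplex n = {y | Monotone y} ∩ Set.pi univ (fun _ => Icc (0:ℝ) 1) := by
    ext y; exact ⟨fun h => ⟨h.1, fun j _ => h.2 j⟩, fun h => ⟨h.1, fun j => h.2 j trivial⟩⟩
  rw [h]
  refine (isCompact_univ_pi fun _ => isCompact_Icc).inter_left ?_
  have : {y : Fin n → ℝ | Monotone y} = ⋂ i, ⋂ j, ⋂ (_ : i ≤ j), {y | y i ≤ y j} := by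
    ext y; simp [Monotone]
  rw [this]
  exact isClosed_iInter fun i => isClosed_iInter fun j => isClosed_iInter fun _ =>
    isClosed_le (continuous_apply i) (continuous_apply j)

lemma sub_mem_of_mem {s t : ℝ} (hs : s ∈ Icc (0:ℝ) 1) (ht : t ∈ Icc (0:ℝ) 1) :
    t - s ∈ Icc (-1:ℝ) 1 := ⟨by linarith [hs.2, ht.1], by linarith [hs.1, ht.2]⟩

section

variable {n : ℕ} {r : Fin n → ℝ} {K J : ℝ → EReal} {k : ℝ → ℝ}

lemma EReal.finset_sum_ne_top {ι : Type*} (s : Finset ι) {f : ι → EReal} (h : ∀ i ∈ s, f i ≠ ⊤) :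
    ∑ i ∈ s, f i ≠ ⊤ := by
  classical
  induction s using Finset.induction_on with
  | empty => simp
  | insert a s ha ih =>
    rw [Finset.sum_insert ha]
    exact EReal.add_ne_top (h _ (by simp)) (ih fun i hi => h i (by simp [hi]))

lemma RegKernel.mul_ne_top (hK : RegKernel K k) {c t : ℝ} (hc : 0 < c) (ht : t ∈ Icc (-1:ℝ) 1) :
    (c : EReal) * K t ≠ ⊤ := by
  rcases eq_or_ne t 0 with rfl | h0
  · rw [hK.zero, EReal.coe_mul_bot_of_pos hc]; simp
  · rw [hK.coe t ht h0, ← EReal.coe_mul]; exact EReal.coe_ne_top _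

lemma EReal.coe_finset_sum' {ι : Type*} (s : Finset ι) (f : ι → ℝ) :
    ((∑ i ∈ s, f i : ℝ) : EReal) = ∑ i ∈ s, (f i : EReal) := by
  classical
  induction s using Finset.induction_on with
  | empty => simp
  | insert a s ha ih => rw [Finset.sum_insert ha, Finset.sum_insert ha, EReal.coe_add, ih]

lemma sumTrans_eq_coe (hK : RegKernel K k) {y : Fin n → ℝ} {t : ℝ}
    (hy : ∀ i, y i ∈ Icc (0:ℝ) 1) (ht : t ∈ Icc (0:ℝ) 1) (hJ : J t ≠ ⊤) (hJ' : J t ≠ ⊥)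
    (hne : ∀ i, t ≠ y i) :
    sumTrans r K J y t = (((J t).toReal + ∑ i, r i * k (t - y i) : ℝ) : EReal) := by
  rw [EReal.coe_add, EReal.coe_toReal hJ hJ', EReal.coe_finset_sum', sumTrans]
  congr 1
  refine Finset.sum_congr rfl fun i _ => ?_
  rw [hK.coe _ (sub_mem_of_mem (hy i) ht) (sub_ne_zero.2 (hne i)), EReal.coe_mul]

lemma EReal.sum_eq_bot {ι : Type*} (s : Finset ι) {f : ι → EReal} {i : ι} (hi : i ∈ s)
    (h : f i = ⊥) : ∑ i ∈ s, f i = ⊥ := by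
  classical
  rw [← Finset.add_sum_erase s f hi, h, EReal.bot_add]

lemma le_sumTrans_iff (hK : RegKernel K k) (hr : ∀ i, 0 < r i) {y : Fin n → ℝ} {t : ℝ}
    (hy : ∀ i, y i ∈ Icc (0:ℝ) 1) (ht : t ∈ Icc (0:ℝ) 1) (hJ : J t ≠ ⊤) (V : ℝ) :
    (V : EReal) ≤ sumTrans r K J y t ↔
      J t ≠ ⊥ ∧ (∀ i, t ≠ y i) ∧ V ≤ (J t).toReal + ∑ i, r i * k (t - y i) := by
  by_cases hJ' : J t = ⊥
  · simp [sumTrans, hJ']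
  by_cases hne : ∀ i, t ≠ y i
  · rw [sumTrans_eq_coe hK hy ht hJ hJ' hne, EReal.coe_le_coe_iff]
    simp [hJ', hne]
  · have : sumTrans r K J y t = ⊥ := by
      push Not at hne
      obtain ⟨i, hi⟩ := hne
      rw [sumTrans, EReal.sum_eq_bot Finset.univ (Finset.mem_univ i), EReal.add_bot]
      rw [hi, sub_self, hK.zero, EReal.coe_mul_bot_of_pos (hr i)]
    simp [this, hne]

lemma sumTrans_ne_bot_iff (hK : RegKernel K k) (hr : ∀ i, 0 < r i) {y : Fin n → ℝ} {t : ℝ}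
    (hy : ∀ i, y i ∈ Icc (0:ℝ) 1) (ht : t ∈ Icc (0:ℝ) 1) (hJ : J t ≠ ⊤) :
    sumTrans r K J y t ≠ ⊥ ↔ J t ≠ ⊥ ∧ ∀ i, t ≠ y i := by
  constructor
  · intro h
    obtain ⟨V, -, hV⟩ := EReal.exists_between_coe_real (bot_lt_iff_ne_bot.2 h)
    exact ⟨((le_sumTrans_iff hK hr hy ht hJ V).1 hV.le).1,
      ((le_sumTrans_iff hK hr hy ht hJ V).1 hV.le).2.1⟩
  · rintro ⟨h1, h2⟩
    rw [sumTrans_eq_coe hK hy ht hJ h1 h2]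
    simp

lemma sumTrans_ne_top (hK : RegKernel K k) (hr : ∀ i, 0 < r i) {y : Fin n → ℝ} {t : ℝ}
    (hy : ∀ i, y i ∈ Icc (0:ℝ) 1) (ht : t ∈ Icc (0:ℝ) 1) (hJ : J t ≠ ⊤) :
    sumTrans r K J y t ≠ ⊤ :=
  EReal.add_ne_top hJ (EReal.finset_sum_ne_top _ fun i _ =>
    hK.mul_ne_top (hr i) (sub_mem_of_mem (hy i) ht))

lemma ContinuousOn.ereal_finset_sum {X ι : Type*} [TopologicalSpace X] {s : Set X}
    (A : Finset ι) {f : ι → X → EReal} (hf : ∀ i ∈ A, ContinuousOn (f i) s)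
    (htop : ∀ i ∈ A, ∀ x ∈ s, f i x ≠ ⊤) : ContinuousOn (fun x => ∑ i ∈ A, f i x) s := by
  classical
  induction A using Finset.induction_on with
  | empty => simpa using continuousOn_const
  | insert a A ha ih =>
    simp only [Finset.sum_insert ha]
    intro x hx
    have h1 := hf a (by simp) x hx
    have h2 := ih (fun i hi => hf i (by simp [hi])) (fun i hi => htop i (by simp [hi])) x hx
    have n1 := htop a (by simp) x hx
    have n2 : ∑ i ∈ A, f i x ≠ ⊤ :=
      EReal.finset_sum_ne_top _ fun i hi => htop i (by simp [hi]) x hx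
    exact (EReal.continuousAt_add (p := (f a x, ∑ i ∈ A, f i x)) (.inl n1) (.inr n2)).tendsto.comp
      (h1.prodMk_nhds h2)

lemma continuousOn_kernelSum (hK : RegKernel K k) (hr : ∀ i, 0 < r i) :
    ContinuousOn (fun p : (Fin n → ℝ) × ℝ => ∑ j, (r j : EReal) * K (p.2 - p.1 j))
      ({y | ∀ i, y i ∈ Icc (0:ℝ) 1} ×ˢ Icc (0:ℝ) 1) := by
  refine ContinuousOn.ereal_finset_sum _ (fun j _ => ?_) fun j _ p hp =>
    hK.mul_ne_top (hr j) (sub_mem_of_mem (hp.1 j) hp.2)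
  have h1 : ContinuousOn (fun p : (Fin n → ℝ) × ℝ => K (p.2 - p.1 j))
      ({y | ∀ i, y i ∈ Icc (0:ℝ) 1} ×ˢ Icc (0:ℝ) 1) :=
    hK.cont.comp (by fun_prop) fun p hp => sub_mem_of_mem (hp.1 j) hp.2
  intro p hp
  exact EReal.Tendsto.const_mul (h1 p hp) (.inl (EReal.coe_ne_bot _)) (.inl (EReal.coe_ne_top _))

lemma upperSemicontinuousOn_sumTrans (hK : RegKernel K k) (hr : ∀ i, 0 < r i)
    (hJ : ∀ t, J t ≠ ⊤) (hJu : UpperSemicontinuousOn J (Icc (0:ℝ) 1)) :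
    UpperSemicontinuousOn (fun p : (Fin n → ℝ) × ℝ => sumTrans r K J p.1 p.2)
      ({y | ∀ i, y i ∈ Icc (0:ℝ) 1} ×ˢ Icc (0:ℝ) 1) := by
  refine UpperSemicontinuousOn.add' (f := fun p : (Fin n → ℝ) × ℝ => J p.2) ?_
    (continuousOn_kernelSum hK hr).upperSemicontinuousOn ?_
  · exact hJu.comp continuous_snd.continuousOn fun p hp => hp.2
  · intro p hp
    have := EReal.finset_sum_ne_top Finset.univ (f := fun j => (r j : EReal) * K (p.2 - p.1 j))
      fun j _ => hK.mul_ne_top (hr j) (sub_mem_of_mem (hp.1 j) hp.2)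
    exact EReal.continuousAt_add (.inl (hJ _)) (.inr this)

lemma upperSemicontinuousOn_sumTrans_right (hK : RegKernel K k) (hr : ∀ i, 0 < r i)
    (hJ : ∀ t, J t ≠ ⊤) (hJu : UpperSemicontinuousOn J (Icc (0:ℝ) 1)) {y : Fin n → ℝ}
    (hy : ∀ i, y i ∈ Icc (0:ℝ) 1) :
    UpperSemicontinuousOn (sumTrans r K J y) (Icc (0:ℝ) 1) :=
  (upperSemicontinuousOn_sumTrans hK hr hJ hJu).comp
    (g := fun t : ℝ => (y, t)) (by fun_prop) fun _ ht => ⟨hy, ht⟩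

lemma continuousOn_sumTrans_left (hK : RegKernel K k) (hr : ∀ i, 0 < r i)
    (hJ : ∀ t, J t ≠ ⊤) {t : ℝ} (ht : t ∈ Icc (0:ℝ) 1) :
    ContinuousOn (fun y : Fin n → ℝ => sumTrans r K J y t) {y | ∀ i, y i ∈ Icc (0:ℝ) 1} := by
  intro y hy
  have h : ContinuousOn (fun y : Fin n → ℝ => ∑ j, (r j : EReal) * K (t - y j))
      {y | ∀ i, y i ∈ Icc (0:ℝ) 1} :=
    (continuousOn_kernelSum hK hr).comp (g := _) (f := fun y : Fin n → ℝ => (y, t))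
      (by fun_prop) fun y hy => ⟨hy, ht⟩
  have n2 := EReal.finset_sum_ne_top Finset.univ (f := fun j => (r j : EReal) * K (t - y j))
      fun j _ => hK.mul_ne_top (hr j) (sub_mem_of_mem (hy j) ht)
  exact (EReal.continuousAt_add (p := (J t, ∑ j, (r j : EReal) * K (t - y j)))
    (.inl (hJ _)) (.inr n2)).tendsto.comp
      ((tendsto_const_nhds (x := J t)).prodMk_nhds (h y hy))

end

section

open Classical in
/-- The contribution of index `j` to the sum of the values `g`, counted positively when `a` switches
off between `j` and `j + 1`, and negatively when it switches on. -/
def switchTerm (a : ℕ → Prop) (g : ℕ → ℝ) (j : ℕ) : ℝ :=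
  (if a j then g j else 0) - (if a (j + 1) then g j else 0)

variable {a : ℕ → Prop} {g : ℕ → ℝ} {l m : ℕ}

lemma switchTerm_of_iff {j : ℕ} (h : a j ↔ a (j + 1)) : switchTerm a g j = 0 := by
  by_cases h' : a (j + 1)
  · simp [switchTerm, h', h.2 h']
  · simp [switchTerm, h', mt h.1 h']

lemma switchTerm_drop {j : ℕ} (h : a j) (h' : ¬ a (j + 1)) : switchTerm a g j = g j := by
  simp [switchTerm, h, h']

lemma switchTerm_rise {j : ℕ} (h : ¬ a j) (h' : a (j + 1)) : switchTerm a g j = -g j := by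
  simp [switchTerm, h, h']

lemma sum_switchTerm_const (c : ℝ) (h0 : ¬ a 0) (N : ℕ) (hN : ¬ a N) :
    ∑ j ∈ Finset.range N, switchTerm a (fun _ => c) j = 0 := by
  classical
  have := Finset.sum_range_sub' (fun j => if a j then c else 0) N
  simpa [switchTerm, h0, hN] using this

lemma sum_switchTerm_antitone (hl : ¬ a l) (hlm : l ≤ m)
    (hg : ∀ j j', l ≤ j → j < j' → j' < m → ¬ (a j ↔ a (j + 1)) → ¬ (a j' ↔ a (j' + 1)) →
      g j' ≤ g j) :
    (¬ a m → ∑ j ∈ Finset.Ico l m, switchTerm a g j ≤ 0) ∧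
    (a m → ∀ B, (∀ j, l ≤ j → j < m → ¬ (a j ↔ a (j + 1)) → B ≤ g j) →
      ∑ j ∈ Finset.Ico l m, switchTerm a g j ≤ -B) := by
  induction m, hlm using Nat.le_induction with
  | base => exact ⟨fun _ => by simp, fun h => absurd h hl⟩
  | succ m hlm ih =>
    obtain ⟨ih0, ih1⟩ := ih fun j j' h1 h2 h3 => hg j j' h1 h2 (by omega)
    rw [Finset.sum_Ico_succ_top hlm]
    by_cases hm : a m <;> by_cases hm' : a (m + 1)
    · rw [switchTerm_of_iff (by simp [hm, hm'])]
      refine ⟨fun h => absurd hm' h, fun _ B hB => ?_⟩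
      linarith [ih1 hm B fun j h1 h2 => hB j h1 (by omega)]
    · rw [switchTerm_drop hm hm']
      refine ⟨fun _ => ?_, fun h => absurd h hm'⟩
      linarith [ih1 hm (g m) fun j h1 h2 h3 => hg j m h1 h2 (by omega) h3 (by simp [hm, hm'])]
    · rw [switchTerm_rise hm hm']
      refine ⟨fun h => absurd hm' h, fun _ B hB => ?_⟩
      linarith [ih0 hm, hB m hlm (by omega) (by simp [hm, hm'])]
    · rw [switchTerm_of_iff (by simp [hm, hm'])]
      exact ⟨fun _ => by linarith [ih0 hm], fun h => absurd h hm'⟩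

lemma sum_switchTerm_monotone_nonneg (hlm : l ≤ m)
    (hg : ∀ j j', l ≤ j → j < j' → j' < m → ¬ (a j ↔ a (j + 1)) → ¬ (a j' ↔ a (j' + 1)) →
      g j ≤ g j')
    (hpos : ∀ j, l ≤ j → j < m → ¬ (a j ↔ a (j + 1)) → 0 ≤ g j) :
    (a m → ∑ j ∈ Finset.Ico l m, switchTerm a g j ≤ 0) ∧
    (¬ a m → ∀ B, 0 ≤ B → (∀ j, l ≤ j → j < m → ¬ (a j ↔ a (j + 1)) → g j ≤ B) →
      ∑ j ∈ Finset.Ico l m, switchTerm a g j ≤ B) := by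
  induction m, hlm using Nat.le_induction with
  | base => exact ⟨fun _ => by simp, fun _ B hB _ => by simpa using hB⟩
  | succ m hlm ih =>
    obtain ⟨ih1, ih0⟩ := ih (fun j j' h1 h2 h3 => hg j j' h1 h2 (by omega))
      fun j h1 h2 => hpos j h1 (by omega)
    rw [Finset.sum_Ico_succ_top hlm]
    by_cases hm : a m <;> by_cases hm' : a (m + 1)
    · rw [switchTerm_of_iff (by simp [hm, hm'])]
      exact ⟨fun _ => by linarith [ih1 hm], fun h => absurd hm' h⟩
    · rw [switchTerm_drop hm hm']
      refine ⟨fun h => absurd h hm', fun _ B _ hB => ?_⟩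
      linarith [ih1 hm, hB m hlm (by omega) (by simp [hm, hm'])]
    · rw [switchTerm_rise hm hm']
      refine ⟨fun _ => ?_, fun h => absurd hm' h⟩
      linarith [ih0 hm (g m) (hpos m hlm (by omega) (by simp [hm, hm']))
        fun j h1 h2 h3 => hg j m h1 h2 (by omega) h3 (by simp [hm, hm'])]
    · rw [switchTerm_of_iff (by simp [hm, hm'])]
      refine ⟨fun h => absurd h hm', fun _ B h0 hB => ?_⟩
      linarith [ih0 hm B h0 fun j h1 h2 => hB j h1 (by omega)]

lemma sum_switchTerm_monotone_neg (hl : a l) (hlm : l ≤ m)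
    (hg : ∀ j j', l ≤ j → j < j' → j' < m → ¬ (a j ↔ a (j + 1)) → ¬ (a j' ↔ a (j' + 1)) →
      g j ≤ g j')
    (hneg : ∀ j, l ≤ j → j < m → ¬ (a j ↔ a (j + 1)) → g j < 0) :
    (a m → ∑ j ∈ Finset.Ico l m, switchTerm a g j ≤ 0) ∧
    (¬ a m → ∑ j ∈ Finset.Ico l m, switchTerm a g j < 0 ∧
      ∀ B, (∀ j, l ≤ j → j < m → ¬ (a j ↔ a (j + 1)) → g j ≤ B) →
      ∑ j ∈ Finset.Ico l m, switchTerm a g j ≤ B) := by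
  induction m, hlm using Nat.le_induction with
  | base => exact ⟨fun _ => by simp, fun h => absurd hl h⟩
  | succ m hlm ih =>
    obtain ⟨ih1, ih0⟩ := ih (fun j j' h1 h2 h3 => hg j j' h1 h2 (by omega))
      fun j h1 h2 => hneg j h1 (by omega)
    rw [Finset.sum_Ico_succ_top hlm]
    by_cases hm : a m <;> by_cases hm' : a (m + 1)
    · rw [switchTerm_of_iff (by simp [hm, hm'])]
      exact ⟨fun _ => by linarith [ih1 hm], fun h => absurd hm' h⟩
    · rw [switchTerm_drop hm hm']
      refine ⟨fun h => absurd h hm', fun _ => ⟨?_, fun B hB => ?_⟩⟩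
      · linarith [ih1 hm, hneg m hlm (by omega) (by simp [hm, hm'])]
      · linarith [ih1 hm, hB m hlm (by omega) (by simp [hm, hm'])]
    · rw [switchTerm_rise hm hm']
      refine ⟨fun _ => ?_, fun h => absurd hm' h⟩
      linarith [(ih0 hm).2 (g m)
        fun j h1 h2 h3 => hg j m h1 h2 (by omega) h3 (by simp [hm, hm'])]
    · rw [switchTerm_of_iff (by simp [hm, hm'])]
      refine ⟨fun h => absurd h hm', fun _ => ⟨by linarith [(ih0 hm).1], fun B hB => ?_⟩⟩
      linarith [(ih0 hm).2 B fun j h1 h2 => hB j h1 (by omega)]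

end

section

variable {n : ℕ} {r : Fin n → ℝ} {K J : ℝ → EReal} {k : ℝ → ℝ}

/-- A non-node of `x` in an interval of `x` that is contained in the corresponding interval of `w`
separates the nodes of both systems in the same way. -/
lemma separates_nodes {x w : Fin n → ℝ} (hx : x ∈ openSimplex n) (hw : w ∈ openSimplex n)
    {j : ℕ} {z : ℝ} (hz : natNode x j ≤ z) (hz' : z ≤ natNode x (j + 1)) (hne : ∀ i, z ≠ x i)
    (h1 : natNode w j ≤ natNode x j) (h2 : natNode x (j + 1) ≤ natNode w (j + 1)) (i : Fin n) :
    ((i : ℕ) + 1 ≤ j → x i < z ∧ w i < z) ∧ (j < (i : ℕ) + 1 → z < x i ∧ z < w i) := by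
  have mx := natNode_monotone (openSimplex_subset_closedSimplex hx)
  have mw := natNode_monotone (openSimplex_subset_closedSimplex hw)
  constructor
  · intro hi
    by_cases hj : j ≤ n
    · obtain ⟨i', rfl, e⟩ := natNode_eq x (j := j) (by omega) hj
      have hzx : x i' < z := lt_of_le_of_ne (e ▸ hz) (hne i').symm
      have e1 := mx hi
      have e2 := mw hi
      simp only [natNode_succ] at e1 e2 h1
      exact ⟨e1.trans_lt hzx, (e2.trans h1).trans_lt hzx⟩
    · have e : natNode x j = 1 := by
        rw [natNode, if_neg (by omega), dif_neg (by omega)]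
      rw [e] at hz
      exact ⟨(hx.2 i).2.trans_le hz, (hw.2 i).2.trans_le hz⟩
  · intro hi
    obtain ⟨i', e', e⟩ := natNode_eq x (j := j + 1) (by omega) (by omega)
    have hzx : z < x i' := lt_of_le_of_ne (e ▸ hz') (hne i')
    have e1 := mx (show j + 1 ≤ (i : ℕ) + 1 by omega)
    have e2 := mw (show j + 1 ≤ (i : ℕ) + 1 by omega)
    rw [natNode_succ, e] at e1
    rw [natNode_succ] at e2
    rw [e] at h2
    exact ⟨hzx.trans_le e1, hzx.trans_le (h2.trans e2)⟩

lemma sub_le_of_le_sumTrans_of_sumTrans_le (hK : RegKernel K k) (hr : ∀ i, 0 < r i)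
    (hJ : ∀ t, J t ≠ ⊤) {x w : Fin n → ℝ} (hx : ∀ i, x i ∈ Icc (0:ℝ) 1)
    (hw : ∀ i, w i ∈ Icc (0:ℝ) 1) {z α β : ℝ} (hz : z ∈ Icc (0:ℝ) 1)
    (h1 : (α : EReal) ≤ sumTrans r K J x z) (h2 : sumTrans r K J w z ≤ β) (hne : ∀ i, z ≠ w i) :
    α - β ≤ ∑ i, r i * (k (z - x i) - k (z - w i)) := by
  obtain ⟨hb, -, h1⟩ := (le_sumTrans_iff hK hr hx hz (hJ z) α).1 h1
  rw [sumTrans_eq_coe hK hw hz (hJ z) hb hne, EReal.coe_le_coe_iff] at h2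
  simp only [mul_sub, Finset.sum_sub_distrib]
  linarith

/-- Two node systems with equal interval maxima are ordered. -/
lemma StrictRegKernel.le_of_equioscillation (hK : StrictRegKernel K k) (hr : ∀ i, 0 < r i)
    (hJ : ∀ t, J t ≠ ⊤) {x w : Fin n → ℝ} (hx : x ∈ openSimplex n) (hw : w ∈ openSimplex n)
    {α β : ℝ} (hxα : ∀ j, ∃ z ∈ nodeInterval x j, (α : EReal) ≤ sumTrans r K J x z)
    (hxα' : ∀ t ∈ Icc (0:ℝ) 1, sumTrans r K J x t ≤ α)
    (hwβ : ∀ j, ∃ z ∈ nodeInterval w j, (β : EReal) ≤ sumTrans r K J w z)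
    (hwβ' : ∀ t ∈ Icc (0:ℝ) 1, sumTrans r K J w t ≤ β) : x ≤ w := by
  classical
  by_contra hcon
  have hx' := (openSimplex_subset_closedSimplex hx).2
  have hw' := (openSimplex_subset_closedSimplex hw).2
  set a : ℕ → Prop := fun j => natNode w j < natNode x j with ha
  have a0 : ¬ a 0 := by simp [ha]
  have aN : ¬ a (n + 1) := by simp [ha]
  have hp : ∀ j, ∃ p : ℝ, j < n + 1 → ¬ (a j ↔ a (j + 1)) → p ∈ Icc (0:ℝ) 1 ∧
      (∀ i : Fin n, ((i : ℕ) + 1 ≤ j → x i < p ∧ w i < p) ∧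
        (j < (i : ℕ) + 1 → p < x i ∧ p < w i)) ∧
      (a j → α - β ≤ ∑ i, r i * (k (p - x i) - k (p - w i))) ∧
      (¬ a j → ∑ i, r i * (k (p - x i) - k (p - w i)) ≤ α - β) := by
    intro j
    by_cases hj : j < n + 1
    swap
    · exact ⟨0, fun h => absurd h hj⟩
    by_cases h1 : a j
    · by_cases h2 : a (j + 1)
      · exact ⟨0, fun _ h => absurd (by simp [h1, h2]) h⟩
      obtain ⟨z, hz, hF⟩ := hxα ⟨j, hj⟩
      have hz1 := nodeInterval_subset hx' _ hz
      rw [mem_nodeInterval] at hz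
      have hne := ((le_sumTrans_iff hK.toRegKernel hr hx' hz1 (hJ z) α).1 hF).2.1
      have hs := separates_nodes hx hw hz.1 hz.2 hne h1.le (not_lt.1 h2)
      refine ⟨z, fun _ _ => ⟨hz1, hs, fun _ => ?_, fun h => absurd h1 h⟩⟩
      refine sub_le_of_le_sumTrans_of_sumTrans_le hK.toRegKernel hr hJ hx' hw' hz1 hF
        (hwβ' z hz1) fun i => ?_
      rcases le_or_gt ((i : ℕ) + 1) j with h | h
      · exact ((hs i).1 h).2.ne'
      · exact ((hs i).2 h).2.ne
    · by_cases h2 : a (j + 1)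
      swap
      · exact ⟨0, fun _ h => absurd (by simp [h1, h2]) h⟩
      obtain ⟨z, hz, hF⟩ := hwβ ⟨j, hj⟩
      have hz1 := nodeInterval_subset hw' _ hz
      rw [mem_nodeInterval] at hz
      have hne := ((le_sumTrans_iff hK.toRegKernel hr hw' hz1 (hJ z) β).1 hF).2.1
      have hs := separates_nodes hw hx hz.1 hz.2 hne (not_lt.1 h1) h2.le
      refine ⟨z, fun _ _ => ⟨hz1, fun i => ⟨fun h => ((hs i).1 h).symm,
        fun h => ((hs i).2 h).symm⟩, fun h => absurd h h1, fun _ => ?_⟩⟩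
      have := sub_le_of_le_sumTrans_of_sumTrans_le hK.toRegKernel hr hJ hw' hx' hz1 hF
        (hxα' z hz1) fun i => by
          rcases le_or_gt ((i : ℕ) + 1) j with h | h
          · exact ((hs i).1 h).2.ne'
          · exact ((hs i).2 h).2.ne
      have e : ∑ i, r i * (k (z - x i) - k (z - w i)) =
          -∑ i, r i * (k (z - w i) - k (z - x i)) := by
        rw [← Finset.sum_neg_distrib]; congr 1; ext i; ring
      linarith
  choose p hp using hp
  have pmono : ∀ j j', j < j' → j' < n + 1 → ¬ (a j ↔ a (j + 1)) → ¬ (a j' ↔ a (j' + 1)) →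
      p j < p j' := by
    intro j j' hjj hj' h h'
    have e1 := ((hp j (by omega) h).2.1 ⟨j, by omega⟩).2 (by simp)
    have e2 := ((hp j' hj' h').2.1 ⟨j, by omega⟩).1 (by simpa using hjj)
    exact e1.1.trans e2.1
  have hsum : 0 ≤ ∑ i, r i *
      ∑ j ∈ Finset.range (n + 1), switchTerm a (fun j => k (p j - x i) - k (p j - w i)) j := by
    have e : ∑ i, r i *
        ∑ j ∈ Finset.range (n + 1), switchTerm a (fun j => k (p j - x i) - k (p j - w i)) j =
        ∑ j ∈ Finset.range (n + 1), switchTerm a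
          (fun j => ∑ i, r i * (k (p j - x i) - k (p j - w i)) - (α - β)) j := by
      have h0 := sum_switchTerm_const (a := a) (α - β) a0 (n + 1) aN
      rw [← sub_zero (∑ i, _), ← h0]
      simp only [Finset.mul_sum]
      rw [Finset.sum_comm, ← Finset.sum_sub_distrib]
      refine Finset.sum_congr rfl fun j _ => ?_
      unfold switchTerm
      split_ifs <;> simp only [zero_sub, sub_zero, sub_self, mul_zero, mul_neg,
        Finset.sum_neg_distrib, Finset.sum_const_zero]
      all_goals ring
    rw [e]
    refine Finset.sum_nonneg fun j hj => ?_
    rw [Finset.mem_range] at hj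
    by_cases h1 : a j <;> by_cases h2 : a (j + 1)
    · rw [switchTerm_of_iff (by simp [h1, h2])]
    · rw [switchTerm_drop h1 h2]
      linarith [(hp j hj (by simp [h1, h2])).2.2.1 h1]
    · rw [switchTerm_rise h1 h2]
      linarith [(hp j hj (by simp [h1, h2])).2.2.2 h1]
    · rw [switchTerm_of_iff (by simp [h1, h2])]
  have hterm : ∀ i : Fin n,
      ∑ j ∈ Finset.range (n + 1), switchTerm a (fun j => k (p j - x i) - k (p j - w i)) j ≤ 0 ∧
      (w i < x i →
      ∑ j ∈ Finset.range (n + 1), switchTerm a (fun j => k (p j - x i) - k (p j - w i)) j < 0) := by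
    intro i
    have hai : a (i + 1) ↔ w i < x i := by simp [ha]
    have xi := hx.2 i
    have wi := hw.2 i
    have left : ∀ j, j < (i : ℕ) + 1 → ¬ (a j ↔ a (j + 1)) →
        p j - x i ∈ Ioo (-1:ℝ) 0 ∧ p j - w i ∈ Ioo (-1:ℝ) 0 := fun j hj hs => by
      obtain ⟨h1, h2, -⟩ := hp j (by omega) hs
      have := (h2 i).2 hj
      constructor <;> constructor <;> linarith [h1.1, this.1, this.2, xi.2, wi.2]
    have right : ∀ j, (i : ℕ) + 1 ≤ j → j < n + 1 → ¬ (a j ↔ a (j + 1)) →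
        p j - x i ∈ Ioo (0:ℝ) 1 ∧ p j - w i ∈ Ioo (0:ℝ) 1 := fun j hj hj' hs => by
      obtain ⟨h1, h2, -⟩ := hp j hj' hs
      have := (h2 i).1 hj
      constructor <;> constructor <;> linarith [h1.2, this.1, this.2, xi.1, wi.1]
    rw [Finset.range_eq_Ico, ← Finset.sum_Ico_consecutive _ (Nat.zero_le (i + 1))
      (show (i : ℕ) + 1 ≤ n + 1 by omega)]
    by_cases hxw : w i < x i
    · suffices h : ∑ j ∈ Finset.Ico 0 ((i : ℕ) + 1),
            switchTerm a (fun j => k (p j - x i) - k (p j - w i)) j +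
          ∑ j ∈ Finset.Ico ((i : ℕ) + 1) (n + 1),
            switchTerm a (fun j => k (p j - x i) - k (p j - w i)) j < 0 from ⟨h.le, fun _ => h⟩
      have e1 := (sum_switchTerm_monotone_nonneg (a := a)
        (g := fun j => k (p j - x i) - k (p j - w i)) (Nat.zero_le (i + 1)) (by
          intro j j' _ hjj hj' hs hs'
          have := pmono j j' hjj (by omega) hs hs'
          have := hK.concave_neg.four_point (left j (by omega) hs).1 (left j' hj' hs').2
            (b := p j - w i) (c := p j' - x i) (by linarith) (by linarith) (by ring)
          linarith) (by
          intro j _ hj hs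
          have := hK.anti (left j hj hs).1 (left j hj hs).2 (by linarith)
          linarith)).1 (hai.2 hxw)
      have e2 := ((sum_switchTerm_monotone_neg (a := a)
        (g := fun j => k (p j - x i) - k (p j - w i)) (hai.2 hxw)
        (show (i : ℕ) + 1 ≤ n + 1 by omega) (by
          intro j j' hj hjj hj' hs hs'
          have := pmono j j' hjj (by omega) hs hs'
          have := hK.concave_pos.four_point (right j hj (by omega) hs).1
            (right j' (by omega) hj' hs').2
            (b := p j - w i) (c := p j' - x i) (by linarith) (by linarith) (by ring)
          linarith) (by
          intro j hj hj' hs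
          have := hK.strictMono (right j hj hj' hs).1 (right j hj hj' hs).2 (by linarith)
          linarith)).2 aN).1
      linarith
    · refine ⟨?_, fun h => absurd h hxw⟩
      rw [not_lt] at hxw
      have hai' : ¬ a (i + 1) := by rw [hai]; exact hxw.not_gt
      have e1 := (sum_switchTerm_antitone (a := a)
        (g := fun j => k (p j - x i) - k (p j - w i)) a0 (Nat.zero_le (i + 1)) (by
          intro j j' _ hjj hj' hs hs'
          have := pmono j j' hjj (by omega) hs hs'
          have := hK.concave_neg.four_point (left j (by omega) hs).2 (left j' hj' hs').1
            (b := p j - x i) (c := p j' - w i) (by linarith) (by linarith) (by ring)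
          linarith)).1 hai'
      have e2 := (sum_switchTerm_antitone (a := a)
        (g := fun j => k (p j - x i) - k (p j - w i)) hai'
        (show (i : ℕ) + 1 ≤ n + 1 by omega) (by
          intro j j' hj hjj hj' hs hs'
          have := pmono j j' hjj (by omega) hs hs'
          have := hK.concave_pos.four_point (right j hj (by omega) hs).2
            (right j' (by omega) hj' hs').1
            (b := p j - x i) (c := p j' - w i) (by linarith) (by linarith) (by ring)
          linarith)).1 aN
      linarith
  rw [Pi.le_def] at hcon
  push Not at hcon
  obtain ⟨i, hi⟩ := hcon
  refine hsum.not_gt (Finset.sum_neg' (fun i _ => ?_) ⟨i, Finset.mem_univ i, ?_⟩)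
  · exact mul_nonpos_of_nonneg_of_nonpos (hr i).le (hterm i).1
  · exact mul_neg_of_pos_of_neg (hr i) ((hterm i).2 hi)

end

section

variable {n : ℕ} {r : Fin n → ℝ} {K J : ℝ → EReal} {k : ℝ → ℝ}

lemma mem_openSimplex_of_forall_ne_bot (hK : RegKernel K k) (hr : ∀ i, 0 < r i)
    (hJ : ∀ t, J t ≠ ⊤) {y : Fin n → ℝ} (hy : y ∈ closedSimplex n)
    (h : ∀ j, ∃ t ∈ nodeInterval y j, sumTrans r K J y t ≠ ⊥) : y ∈ openSimplex n := by
  have key : ∀ j : Fin (n + 1), ∃ t ∈ Icc (0:ℝ) 1, natNode y j ≤ t ∧ t ≤ natNode y (j + 1) ∧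
      ∀ i, t ≠ y i := fun j => by
    obtain ⟨t, ht, hb⟩ := h j
    have ht1 := nodeInterval_subset hy.2 _ ht
    rw [mem_nodeInterval] at ht
    exact ⟨t, ht1, ht.1, ht.2, ((sumTrans_ne_bot_iff hK hr hy.2 ht1 (hJ t)).1 hb).2⟩
  refine ⟨fun i i' hi => ?_, fun i => ⟨?_, ?_⟩⟩
  · obtain ⟨t, -, h1, h2, h3⟩ := key i.succ
    have e := natNode_monotone hy (show (i : ℕ) + 1 + 1 ≤ i' + 1 by
      have : (i : ℕ) < i' := hi
      omega)
    simp only [Fin.val_succ, natNode_succ] at h1 h2 e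
    exact (lt_of_le_of_ne h1 (h3 i).symm).trans_le (h2.trans e)
  · obtain ⟨t, ht, -, h2, h3⟩ := key i.castSucc
    simp only [Fin.val_castSucc, natNode_succ] at h2
    exact ht.1.trans_lt (lt_of_le_of_ne h2 (h3 i))
  · obtain ⟨t, ht, h1, -, h3⟩ := key i.succ
    simp only [Fin.val_succ, natNode_succ] at h1
    exact (lt_of_le_of_ne h1 (h3 i).symm).trans_le ht.2

lemma closedSimplex_nonempty (n : ℕ) : (closedSimplex n).Nonempty :=
  ⟨fun _ => 0, monotone_const, fun _ => by simp⟩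

/-- The supremum of `F(y, ·)` attains its minimum over the closed simplex. -/
lemma exists_minimax (hK : RegKernel K k) (hr : ∀ i, 0 < r i)
    (hJ : ∀ t, J t ≠ ⊤) (hJu : UpperSemicontinuousOn J (Icc (0:ℝ) 1))
    (hfin : ∀ y ∈ closedSimplex n, ∃ t ∈ Icc (0:ℝ) 1, sumTrans r K J y t ≠ ⊥) :
    ∃ w ∈ closedSimplex n, ∃ V : ℝ, (∀ t ∈ Icc (0:ℝ) 1, sumTrans r K J w t ≤ V) ∧
      ∀ y ∈ closedSimplex n, ∃ t ∈ Icc (0:ℝ) 1, (V : EReal) ≤ sumTrans r K J y t := by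
  have hmax : ∀ y ∈ closedSimplex n, ∃ t ∈ Icc (0:ℝ) 1,
      ⨆ t ∈ Icc (0:ℝ) 1, sumTrans r K J y t = sumTrans r K J y t := fun y hy => by
    obtain ⟨t, ht, hm⟩ := (upperSemicontinuousOn_sumTrans_right hK hr hJ hJu hy.2).exists_isMaxOn
      (nonempty_Icc.2 zero_le_one) isCompact_Icc
    exact ⟨t, ht, le_antisymm (iSup₂_le fun s hs => hm hs)
      (le_iSup₂ (f := fun t _ => sumTrans r K J y t) t ht)⟩
  have hlsc : LowerSemicontinuousOn
      (fun y : Fin n → ℝ => ⨆ t ∈ Icc (0:ℝ) 1, sumTrans r K J y t) (closedSimplex n) :=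
    lowerSemicontinuousOn_biSup fun t ht =>
      ((continuousOn_sumTrans_left hK hr hJ ht).mono fun y hy => hy.2).lowerSemicontinuousOn
  obtain ⟨w, hw, hmin⟩ := hlsc.exists_isMinOn (closedSimplex_nonempty n) (closedSimplex_isCompact n)
  obtain ⟨t, ht, e⟩ := hmax w hw
  have hb : sumTrans r K J w t ≠ ⊥ := fun hb => by
    obtain ⟨s, hs, hsb⟩ := hfin w hw
    refine hsb (le_bot_iff.1 ?_)
    rw [← hb, ← e]
    exact le_iSup₂ (f := fun t _ => sumTrans r K J w t) s hs
  have hV := EReal.coe_toReal (sumTrans_ne_top hK hr hw.2 ht (hJ t)) hb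
  refine ⟨w, hw, (sumTrans r K J w t).toReal, fun s hs => ?_, fun y hy => ?_⟩
  · rw [hV, ← e]
    exact le_iSup₂ (f := fun t _ => sumTrans r K J w t) s hs
  · obtain ⟨s, hs, e'⟩ := hmax y hy
    refine ⟨s, hs, ?_⟩
    rw [hV, ← e, ← e']
    exact hmin hy

lemma eventually_add_smul_mem_closedSimplex {w v : Fin n → ℝ} (hw : w ∈ closedSimplex n)
    (h1 : ∀ i i', i < i' → w i = w i' → v i ≤ v i') (h2 : ∀ i, w i = 0 → 0 ≤ v i)
    (h3 : ∀ i, w i = 1 → v i ≤ 0) :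
    ∀ᶠ δ : ℝ in nhdsWithin 0 (Ioi 0), w + δ • v ∈ closedSimplex n := by
  have e1 : ∀ᶠ δ : ℝ in nhdsWithin 0 (Ioi 0), ∀ i i', i < i' →
      w i + δ * v i ≤ w i' + δ * v i' := by
    refine eventually_all.2 fun i => eventually_all.2 fun i' => ?_
    by_cases hi : i < i'
    swap
    · exact Eventually.of_forall fun _ h => absurd h hi
    rcases (hw.1 hi.le).eq_or_lt with he | hl
    · filter_upwards [self_mem_nhdsWithin] with δ hδ _
      have := mul_le_mul_of_nonneg_left (h1 i i' hi he) (le_of_lt (mem_Ioi.1 hδ))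
      linarith
    · have : ∀ᶠ δ : ℝ in nhds 0, w i + δ * v i < w i' + δ * v i' :=
        ContinuousAt.eventually_lt (by fun_prop) (by fun_prop) (by simpa using hl)
      filter_upwards [nhdsWithin_le_nhds this] with δ hδ _ using hδ.le
  have e2 : ∀ᶠ δ : ℝ in nhdsWithin 0 (Ioi 0), ∀ i, 0 ≤ w i + δ * v i := by
    refine eventually_all.2 fun i => ?_
    rcases (hw.2 i).1.eq_or_lt with he | hl
    · filter_upwards [self_mem_nhdsWithin] with δ hδ
      have := mul_nonneg (le_of_lt (mem_Ioi.1 hδ)) (h2 i he.symm)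
      linarith
    · have : ∀ᶠ δ : ℝ in nhds 0, 0 < w i + δ * v i :=
        ContinuousAt.eventually_lt (by fun_prop) (by fun_prop) (by simpa using hl)
      filter_upwards [nhdsWithin_le_nhds this] with δ hδ using hδ.le
  have e3 : ∀ᶠ δ : ℝ in nhdsWithin 0 (Ioi 0), ∀ i, w i + δ * v i ≤ 1 := by
    refine eventually_all.2 fun i => ?_
    rcases (hw.2 i).2.eq_or_lt with he | hl
    · filter_upwards [self_mem_nhdsWithin] with δ hδ
      have := mul_nonneg (le_of_lt (mem_Ioi.1 hδ)) (sub_nonneg.2 (h3 i he))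
      linarith
    · have : ∀ᶠ δ : ℝ in nhds 0, w i + δ * v i < 1 :=
        ContinuousAt.eventually_lt (by fun_prop) (by fun_prop) (by simpa using hl)
      filter_upwards [nhdsWithin_le_nhds this] with δ hδ using hδ.le
  filter_upwards [e1, e2, e3] with δ d1 d2 d3
  refine ⟨fun i i' hi => ?_, fun i => ⟨by simpa using d2 i, by simpa using d3 i⟩⟩
  rcases hi.eq_or_lt with rfl | hi
  · exact le_rfl
  · simpa using d1 i i' hi

/-- At a minimizer there is no feasible direction that decreases the kernel sum outside an
interval on which the maximum is not attained. -/
lemma not_descent_direction (hK : RegKernel K k) (hr : ∀ i, 0 < r i)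
    (hJ : ∀ t, J t ≠ ⊤) (hJu : UpperSemicontinuousOn J (Icc (0:ℝ) 1))
    {w v : Fin n → ℝ} (hw : w ∈ closedSimplex n) {V : ℝ} {s : Set ℝ}
    (hmax : ∀ t ∈ Icc (0:ℝ) 1, sumTrans r K J w t ≤ V)
    (hmin : ∀ y ∈ closedSimplex n, ∃ t ∈ Icc (0:ℝ) 1, (V : EReal) ≤ sumTrans r K J y t)
    (hv : ∀ᶠ δ : ℝ in nhdsWithin 0 (Ioi 0), w + δ • v ∈ closedSimplex n)
    (hin : ∀ t ∈ s, sumTrans r K J w t < V)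
    (hout : ∀ t ∈ Icc (0:ℝ) 1, t ∉ s → ∀ᶠ q : ℝ × ℝ in nhds (0, t), 0 < q.1 →
      q.2 ∈ Icc (0:ℝ) 1 → (∀ i, v i ≠ 0 → q.2 ≠ w i) ∧
        ∑ i, r i * (k (q.2 - (w i + q.1 * v i)) - k (q.2 - w i)) < 0) : False := by
  have key : ∀ t ∈ Icc (0:ℝ) 1, ∀ᶠ q : ℝ × ℝ in nhds (0, t), 0 < q.1 →
      q.2 ∈ Icc (0:ℝ) 1 → w + q.1 • v ∈ closedSimplex n →
      sumTrans r K J (w + q.1 • v) q.2 < V := by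
    intro t ht
    by_cases hts : t ∈ s
    · have hu := upperSemicontinuousOn_sumTrans (n := n) hK hr hJ hJu (w, t) ⟨hw.2, ht⟩ V (hin t hts)
      rw [eventually_nhdsWithin_iff] at hu
      have hc : Tendsto (fun q : ℝ × ℝ => (w + q.1 • v, q.2)) (nhds (0, t)) (nhds (w, t)) := by
        have : Continuous (fun q : ℝ × ℝ => (w + q.1 • v, q.2)) := by fun_prop
        simpa using this.tendsto (0, t)
      filter_upwards [hc.eventually hu] with q hq _ hq2 hq3
      exact hq ⟨hq3.2, hq2⟩
    · filter_upwards [hout t ht hts] with q hq h0 hq2 hq3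
      obtain ⟨hq4, hq5⟩ := hq h0 hq2
      by_contra hcon
      obtain ⟨hb, hne, hle⟩ := (le_sumTrans_iff hK hr hq3.2 hq2 (hJ _) V).1 (not_lt.1 hcon)
      have hne' : ∀ i, q.2 ≠ w i := fun i => by
        by_cases hvi : v i = 0
        · simpa [hvi] using hne i
        · exact hq4 i hvi
      have h3 := hmax _ hq2
      rw [sumTrans_eq_coe hK hw.2 hq2 (hJ _) hb hne', EReal.coe_le_coe_iff] at h3
      simp only [mul_sub, Finset.sum_sub_distrib] at hq5
      simp only [Pi.add_apply, Pi.smul_apply, smul_eq_mul] at hle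
      linarith
  have h2 := Eventually.filter_mono (nhdsWithin_le_nhds (s := Ioi (0:ℝ)))
    (isCompact_Icc.eventually_forall_of_forall_eventually
    (x₀ := (0:ℝ)) (P := fun δ t => 0 < δ → t ∈ Icc (0:ℝ) 1 → w + δ • v ∈ closedSimplex n →
      sumTrans r K J (w + δ • v) t < V) key)
  obtain ⟨δ, h2, h3, h4⟩ := (h2.and (hv.and self_mem_nhdsWithin)).exists
  obtain ⟨t, ht, h5⟩ := hmin _ h3
  exact (h2 t ht h4 ht h3).not_ge h5

lemma StrictRegKernel.strictMonoOn_Ioc (hK : StrictRegKernel K k) :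
    StrictMonoOn k (Ioc (0:ℝ) 1) := by
  intro s hs t ht hst
  rcases ht.2.eq_or_lt with rfl | ht1
  swap
  · exact hK.strictMono ⟨hs.1, hst.trans ht1⟩ ⟨ht.1, ht1⟩ hst
  obtain ⟨m, hsm, hm⟩ := exists_between hst
  have hm0 := hs.1.trans hsm
  refine (hK.strictMono ⟨hs.1, hst⟩ ⟨hm0, hm⟩ hsm).trans_le ?_
  have hc := (hK.cont 1 (by simp)).mono (show Ioo m 1 ⊆ Icc (-1) 1 from fun x hx =>
    ⟨by linarith [hx.1], hx.2.le⟩)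
  have : (nhdsWithin (1:ℝ) (Ioo m 1)).NeBot := right_nhdsWithin_Ioo_neBot hm
  have hle : (k m : EReal) ≤ K 1 := ge_of_tendsto hc <| by
    filter_upwards [self_mem_nhdsWithin] with x hx
    rw [hK.coe x ⟨by linarith [hx.1], hx.2.le⟩ (by linarith [hx.1]), EReal.coe_le_coe_iff]
    exact hK.mono ⟨hm0, hm⟩ ⟨hm0.trans hx.1, hx.2⟩ hx.1.le
  rwa [hK.coe 1 (by simp) one_ne_zero, EReal.coe_le_coe_iff] at hle

lemma StrictRegKernel.strictAntiOn_Ico (hK : StrictRegKernel K k) :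
    StrictAntiOn k (Ico (-1:ℝ) 0) := by
  intro t ht s hs hst
  rcases ht.1.eq_or_lt with rfl | ht1
  swap
  · exact hK.strictAnti ⟨ht1, ht.2⟩ ⟨ht1.trans hst, hs.2⟩ hst
  obtain ⟨m, hm, hsm⟩ := exists_between hst
  have hm0 := hsm.trans hs.2
  refine (hK.strictAnti ⟨hm, hm0⟩ ⟨hst, hs.2⟩ hsm).trans_le ?_
  have hc := (hK.cont (-1) (by simp)).mono (show Ioo (-1) m ⊆ Icc (-1) 1 from fun x hx =>
    ⟨hx.1.le, by linarith [hx.2]⟩)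
  have : (nhdsWithin (-1:ℝ) (Ioo (-1) m)).NeBot := left_nhdsWithin_Ioo_neBot hm
  have hle : (k m : EReal) ≤ K (-1) := ge_of_tendsto hc <| by
    filter_upwards [self_mem_nhdsWithin] with x hx
    rw [hK.coe x ⟨hx.1.le, by linarith [hx.2]⟩ (by linarith [hx.2]), EReal.coe_le_coe_iff]
    exact hK.anti ⟨hx.1, hx.2.trans hm0⟩ ⟨hm, hm0⟩ hx.2.le
  rwa [hK.coe (-1) (by simp) (by norm_num), EReal.coe_le_coe_iff] at hle

end

section

variable {n : ℕ} {r : Fin n → ℝ} {K J : ℝ → EReal} {k : ℝ → ℝ}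

/-- For a strictly concave strictly monotone kernel, a minimizer equioscillates. -/
lemma StrictRegKernel.exists_le_of_minimizer (hK : StrictRegKernel K k)
    (hneg : StrictConcaveOn ℝ (Ioo (-1:ℝ) 0) k) (hpos : StrictConcaveOn ℝ (Ioo (0:ℝ) 1) k)
    (hr : ∀ i, 0 < r i) (hJ : ∀ t, J t ≠ ⊤) (hJu : UpperSemicontinuousOn J (Icc (0:ℝ) 1))
    {w : Fin n → ℝ} (hw : w ∈ closedSimplex n) {V : ℝ}
    (hmax : ∀ t ∈ Icc (0:ℝ) 1, sumTrans r K J w t ≤ V)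
    (hmin : ∀ y ∈ closedSimplex n, ∃ t ∈ Icc (0:ℝ) 1, (V : EReal) ≤ sumTrans r K J y t)
    (j : Fin (n + 1)) : ∃ t ∈ nodeInterval w j, (V : EReal) ≤ sumTrans r K J w t := by
  classical
  by_contra! hin
  have hright : natNode w (j + 1) ≠ 1 → ∃ b : Fin n, w b = natNode w (j + 1) ∧
      (j : ℕ) ≤ b ∧ ∀ i, w i = w b → i ≤ b := fun h1 => by
    have hj : (j : ℕ) + 1 ≤ n := by
      by_contra hc
      exact h1 (by rw [show (j : ℕ) + 1 = n + 1 by omega, natNode_last])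
    obtain ⟨i₀, hi₀, e⟩ := natNode_eq w (j := j + 1) (by omega) hj
    obtain ⟨b, hb, hbm⟩ := (Finset.univ.filter fun i => w i = w i₀).exists_max_image id
      ⟨i₀, by simp⟩
    simp only [Finset.mem_filter, Finset.mem_univ, true_and, id] at hb hbm
    refine ⟨b, by rw [hb, e], ?_, fun i hi => hbm i (hi.trans hb)⟩
    have := Fin.le_def.1 (hbm i₀ rfl)
    omega
  have hleft : natNode w j ≠ 0 → ∃ a : Fin n, w a = natNode w j ∧
      (a : ℕ) < j ∧ ∀ i, w i = w a → a ≤ i := fun h1 => by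
    have hj : 1 ≤ (j : ℕ) := by
      by_contra hc
      exact h1 (by rw [show (j : ℕ) = 0 by omega, natNode_zero])
    obtain ⟨i₀, hi₀, e⟩ := natNode_eq w (j := j) hj (by omega)
    obtain ⟨a, ha, ham⟩ := (Finset.univ.filter fun i => w i = w i₀).exists_min_image id
      ⟨i₀, by simp⟩
    simp only [Finset.mem_filter, Finset.mem_univ, true_and, id] at ha ham
    refine ⟨a, by rw [ha, e], ?_, fun i hi => ham i (hi.trans ha)⟩
    have := Fin.le_def.1 (ham i₀ rfl)
    omega
  have hp := natNode_mem hw.2 j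
  have hq := natNode_mem hw.2 (j + 1)
  have hpq := natNode_le_succ hw j
  by_cases h0 : natNode w j = 0 <;> by_cases h1 : natNode w (j + 1) = 1
  · obtain ⟨t, ht, hV⟩ := hmin w hw
    exact (hin t ((mem_nodeInterval _ _ _).2 ⟨h0 ▸ ht.1, h1 ▸ ht.2⟩)).not_ge hV
  · obtain ⟨b, hb, -, hbm⟩ := hright h1
    have hq1 := lt_of_le_of_ne hq.2 h1
    refine not_descent_direction (v := Pi.single b 1) hK.toRegKernel hr hJ hJu hw hmax hmin
      (eventually_add_smul_mem_closedSimplex hw (fun i i' hi hii => ?_) (fun i _ => ?_)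
        fun i hi => ?_) hin fun t ht hts => ?_
    · by_cases h : i = b
      · subst h
        exact absurd (hbm i' hii.symm) (not_le.2 hi)
      · rw [Pi.single_eq_of_ne h]
        by_cases h' : i' = b
        · subst h'; simp
        · rw [Pi.single_eq_of_ne h']
    · by_cases h : i = b
      · subst h; simp
      · rw [Pi.single_eq_of_ne h]
    · by_cases h : i = b
      · subst h; linarith
      · rw [Pi.single_eq_of_ne h]
    · have htq : w b < t := by
        by_contra hc
        exact hts ((mem_nodeInterval _ _ _).2 ⟨h0 ▸ ht.1, by linarith⟩)
      have e1 : ∀ᶠ q : ℝ × ℝ in nhds (0, t), w b + q.1 < q.2 :=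
        ContinuousAt.eventually_lt (by fun_prop) (by fun_prop) (by simpa using htq)
      filter_upwards [e1] with q e1 hq0 hq2
      refine ⟨fun i hi => ?_, ?_⟩
      · by_cases h : i = b
        · subst h; linarith
        · exact absurd (Pi.single_eq_of_ne h _) hi
      · rw [Fintype.sum_eq_single b fun i hi => by simp [Pi.single_eq_of_ne hi]]
        have := hK.strictMonoOn_Ioc (a := q.2 - (w b + q.1)) (b := q.2 - w b)
          ⟨by linarith, by linarith [hq2.2, (hw.2 b).1]⟩
          ⟨by linarith, by linarith [hq2.2, (hw.2 b).1]⟩ (by linarith)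
        simp only [Pi.single_eq_same, mul_one]
        exact mul_neg_of_pos_of_neg (hr b) (by linarith)
  · obtain ⟨a, ha, -, ham⟩ := hleft h0
    have hp0 := lt_of_le_of_ne hp.1 (Ne.symm h0)
    refine not_descent_direction (v := Pi.single a (-1)) hK.toRegKernel hr hJ hJu hw hmax hmin
      (eventually_add_smul_mem_closedSimplex hw (fun i i' hi hii => ?_) (fun i hi => ?_)
        fun i _ => ?_) hin fun t ht hts => ?_
    · by_cases h : i' = a
      · subst h
        exact absurd (ham i hii) (not_le.2 hi)
      · rw [Pi.single_eq_of_ne h]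
        by_cases h' : i = a
        · subst h'; simp
        · rw [Pi.single_eq_of_ne h']
    · by_cases h : i = a
      · subst h; linarith
      · rw [Pi.single_eq_of_ne h]
    · by_cases h : i = a
      · subst h; simp
      · rw [Pi.single_eq_of_ne h]
    · have htq : t < w a := by
        by_contra hc
        exact hts ((mem_nodeInterval _ _ _).2 ⟨by linarith, h1 ▸ ht.2⟩)
      have e1 : ∀ᶠ q : ℝ × ℝ in nhds (0, t), q.2 < w a - q.1 :=
        ContinuousAt.eventually_lt (by fun_prop) (by fun_prop) (by simpa using htq)
      filter_upwards [e1] with q e1 hq0 hq2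
      refine ⟨fun i hi => ?_, ?_⟩
      · by_cases h : i = a
        · subst h; linarith
        · exact absurd (Pi.single_eq_of_ne h _) hi
      · rw [Fintype.sum_eq_single a fun i hi => by simp [Pi.single_eq_of_ne hi]]
        have := hK.strictAntiOn_Ico (b := q.2 - (w a - q.1)) (a := q.2 - w a)
          ⟨by linarith [hq2.1, (hw.2 a).2], by linarith⟩
          ⟨by linarith [hq2.1, (hw.2 a).2], by linarith⟩ (by linarith)
        simp only [Pi.single_eq_same, mul_neg, mul_one, ← sub_eq_add_neg]
        exact mul_neg_of_pos_of_neg (hr a) (by linarith)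
  · obtain ⟨b, hb, hjb, hbm⟩ := hright h1
    obtain ⟨a, ha, haj, ham⟩ := hleft h0
    have hp0 := lt_of_le_of_ne hp.1 (Ne.symm h0)
    have hq1 := lt_of_le_of_ne hq.2 h1
    have hab : a ≠ b := by rintro rfl; omega
    have hwab : w a ≤ w b := by rw [ha, hb]; exact hpq
    have ra := hr a
    have rb := hr b
    set v : Fin n → ℝ := fun i => if i = a then -(1 / r a) else if i = b then 1 / r b else 0 with hv
    have va : v a = -(1 / r a) := by simp [hv]
    have vb : v b = 1 / r b := by simp [hv, hab.symm]
    have vo : ∀ i, i ≠ a → i ≠ b → v i = 0 := fun i h h' => by simp [hv, h, h']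
    have ra' : 0 < 1 / r a := by positivity
    have rb' : 0 < 1 / r b := by positivity
    refine not_descent_direction (v := v) hK.toRegKernel hr hJ hJu hw hmax hmin
      (eventually_add_smul_mem_closedSimplex hw (fun i i' hi hii => ?_) (fun i hi => ?_)
        fun i hi => ?_) hin fun t ht hts => ?_
    · by_cases h : i = b
      · subst h
        exact absurd (hbm i' hii.symm) (not_le.2 hi)
      by_cases h' : i' = a
      · subst h'
        exact absurd (ham i hii) (not_le.2 hi)
      have e1 : v i ≤ 0 := by
        by_cases h2 : i = a
        · rw [h2, va]; linarith
        · rw [vo i h2 h]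
      have e2 : 0 ≤ v i' := by
        by_cases h2 : i' = b
        · rw [h2, vb]; linarith
        · rw [vo i' h' h2]
      exact e1.trans e2
    · have h2 : i ≠ a := by rintro rfl; linarith
      by_cases h3 : i = b
      · rw [h3, vb]; linarith
      · rw [vo i h2 h3]
    · have h2 : i ≠ b := by rintro rfl; linarith
      by_cases h3 : i = a
      · rw [h3, va]; linarith
      · rw [vo i h3 h2]
    · have main : ∀ᶠ q : ℝ × ℝ in nhds (0, t), 0 < q.1 → q.2 ∈ Icc (0:ℝ) 1 →
          (q.2 ≠ w a ∧ q.2 ≠ w b) ∧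
          (k (q.2 - w a + q.1 * (1 / r a)) - k (q.2 - w a)) / (q.1 * (1 / r a)) <
            (k (q.2 - w b) - k (q.2 - w b - q.1 * (1 / r b))) / (q.1 * (1 / r b)) := by
        have e2 : ∀ᶠ q : ℝ × ℝ in nhds (0, t), w b + q.1 * (1 / r b) < 1 :=
          ContinuousAt.eventually_lt (by fun_prop) (by fun_prop) (by simp; linarith)
        have e3 : ∀ᶠ q : ℝ × ℝ in nhds (0, t), q.1 * (1 / r a) < w a :=
          ContinuousAt.eventually_lt (by fun_prop) (by fun_prop) (by simp; linarith)
        rcases lt_or_ge (w b) t with htq | htq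
        · have e1 : ∀ᶠ q : ℝ × ℝ in nhds (0, t), w b + q.1 * (1 / r b) < q.2 :=
            ContinuousAt.eventually_lt (by fun_prop) (by fun_prop) (by simpa using htq)
          filter_upwards [e1, e2, e3] with q e1 e2 e3 hq0 hq2
          have d1 := mul_pos hq0 ra'
          have d2 := mul_pos hq0 rb'
          refine ⟨⟨by linarith, by linarith⟩, ?_⟩
          have := hpos.slope_lt (a := q.2 - w b - q.1 * (1 / r b)) (b := q.2 - w b)
            (c := q.2 - w a) (d := q.2 - w a + q.1 * (1 / r a))
            ⟨by linarith, by linarith [hq2.2]⟩ ⟨by linarith, by linarith [hq2.2]⟩ (by linarith)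
            (by linarith) (by linarith)
          rwa [add_sub_cancel_left, sub_sub_cancel] at this
        · have htp : t < w a := by
            by_contra hc
            exact hts ((mem_nodeInterval _ _ _).2 ⟨by linarith, by linarith⟩)
          have e1 : ∀ᶠ q : ℝ × ℝ in nhds (0, t), q.2 < w a - q.1 * (1 / r a) :=
            ContinuousAt.eventually_lt (by fun_prop) (by fun_prop) (by simpa using htp)
          filter_upwards [e1, e2, e3] with q e1 e2 e3 hq0 hq2
          have d1 := mul_pos hq0 ra'
          have d2 := mul_pos hq0 rb'
          refine ⟨⟨by linarith, by linarith⟩, ?_⟩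
          have := hneg.slope_lt (a := q.2 - w b - q.1 * (1 / r b)) (b := q.2 - w b)
            (c := q.2 - w a) (d := q.2 - w a + q.1 * (1 / r a))
            ⟨by linarith [hq2.1], by linarith⟩ ⟨by linarith [hq2.1], by linarith⟩ (by linarith)
            (by linarith) (by linarith)
          rwa [add_sub_cancel_left, sub_sub_cancel] at this
      filter_upwards [main] with q hq' hq0 hq2
      obtain ⟨⟨n1, n2⟩, hlt⟩ := hq' hq0 hq2
      refine ⟨fun i hi => ?_, ?_⟩
      · by_cases h2 : i = a
        · rwa [h2]
        by_cases h3 : i = b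
        · rwa [h3]
        exact absurd (vo i h2 h3) hi
      · rw [Fintype.sum_eq_add a b hab fun i hi => by simp [vo i hi.1 hi.2], va, vb]
        have x1 : q.2 - (w a + q.1 * -(1 / r a)) = q.2 - w a + q.1 * (1 / r a) := by ring
        have x2 : q.2 - (w b + q.1 * (1 / r b)) = q.2 - w b - q.1 * (1 / r b) := by ring
        rw [x1, x2]
        have y1 : ∀ c, c / (q.1 * (1 / r a)) = r a * c / q.1 := fun c => by field_simp
        have y2 : ∀ c, c / (q.1 * (1 / r b)) = r b * c / q.1 := fun c => by field_simp
        rw [y1, y2, div_lt_div_iff_of_pos_right hq0] at hlt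
        linarith

/-- Existence of an equioscillating minimizer for a strictly concave strictly monotone kernel. -/
lemma StrictRegKernel.exists_equioscillation (hK : StrictRegKernel K k)
    (hneg : StrictConcaveOn ℝ (Ioo (-1:ℝ) 0) k) (hpos : StrictConcaveOn ℝ (Ioo (0:ℝ) 1) k)
    (hr : ∀ i, 0 < r i) (hJ : ∀ t, J t ≠ ⊤) (hJu : UpperSemicontinuousOn J (Icc (0:ℝ) 1))
    (hfin : ∀ y ∈ closedSimplex n, ∃ t ∈ Icc (0:ℝ) 1, sumTrans r K J y t ≠ ⊥) :
    ∃ w ∈ closedSimplex n, ∃ V : ℝ, (∀ t ∈ Icc (0:ℝ) 1, sumTrans r K J w t ≤ V) ∧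
      (∀ j, ∃ t ∈ nodeInterval w j, (V : EReal) ≤ sumTrans r K J w t) ∧
      ∀ y ∈ closedSimplex n, ∃ t ∈ Icc (0:ℝ) 1, (V : EReal) ≤ sumTrans r K J y t := by
  obtain ⟨w, hw, V, hmax, hmin⟩ := exists_minimax hK.toRegKernel hr hJ hJu hfin
  exact ⟨w, hw, V, hmax, hK.exists_le_of_minimizer hneg hpos hr hJ hJu hw hmax hmin, hmin⟩

/-- By the pigeonhole principle, some point of a set with more than `n` elements is no node. -/
lemma exists_ne_node {T : Finset ℝ} (hT : n < T.card) (y : Fin n → ℝ) :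
    ∃ t ∈ T, ∀ i, t ≠ y i := by
  classical
  by_contra! h
  have hsub : T ⊆ Finset.univ.image y := fun t ht => by
    obtain ⟨i, hi⟩ := h t ht
    simp [hi]
  have := (Finset.card_le_card hsub).trans Finset.card_image_le
  simp at this
  omega

end

section

variable {n : ℕ} {r : Fin n → ℝ} {K J : ℝ → EReal} {k : ℝ → ℝ}

open Classical in
/-- A function that is finite at finitely many points only is upper semicontinuous. -/
lemma upperSemicontinuous_ite_mem_finset (T : Finset ℝ) (g : ℝ → EReal) :
    UpperSemicontinuous fun t => if t ∈ T then g t else ⊥ := by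
  intro t a hta
  have hcl : IsClosed ((T.erase t : Finset ℝ) : Set ℝ) := (T.erase t).finite_toSet.isClosed
  filter_upwards [hcl.isOpen_compl.mem_nhds (x := t) (by simp)] with s hs
  by_cases hst : s = t
  · rwa [hst]
  · have : s ∉ T := fun h => hs (by simp [hst, h])
    simpa [this] using bot_le.trans_lt hta

lemma StrictRegKernel.sandwich (hK : StrictRegKernel K k)
    (hneg : StrictConcaveOn ℝ (Ioo (-1:ℝ) 0) k) (hpos : StrictConcaveOn ℝ (Ioo (0:ℝ) 1) k)
    (hr : ∀ i, 0 < r i) (hJ : ∀ t, J t ≠ ⊤) {x y : Fin n → ℝ} (hx : x ∈ openSimplex n)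
    (hy : y ∈ closedSimplex n) {c : ℝ}
    (hc : ∀ j, ∃ z ∈ nodeInterval x j, (c : EReal) ≤ sumTrans r K J x z) :
    ∃ t ∈ Icc (0:ℝ) 1, (c : EReal) ≤ sumTrans r K J y t := by
  classical
  have hx' := (openSimplex_subset_closedSimplex hx).2
  choose z hz hcz using hc
  have hz1 : ∀ j, z j ∈ Icc (0:ℝ) 1 := fun j => nodeInterval_subset hx' j (hz j)
  have hzr := fun j => (le_sumTrans_iff hK.toRegKernel hr hx' (hz1 j) (hJ (z j)) c).1 (hcz j)
  have hzmono : StrictMono z := fun j j' hj => by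
    have hj' : (j : ℕ) < j' := hj
    obtain ⟨i, -, e⟩ := natNode_eq x (j := j + 1) (by omega) (by omega)
    have h1 := ((mem_nodeInterval _ _ _).1 (hz j)).2
    have h2 := ((mem_nodeInterval _ _ _).1 (hz j')).1
    have h3 := natNode_monotone (openSimplex_subset_closedSimplex hx)
      (show (j : ℕ) + 1 ≤ j' by omega)
    rw [e] at h1 h3
    exact (lt_of_le_of_ne h1 ((hzr j).2.1 i)).trans_le (h3.trans h2)
  set T : Finset ℝ := Finset.univ.image z with hT
  have hTcard : n < T.card := by
    rw [hT, Finset.card_image_of_injective _ hzmono.injective]; simp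
  have hTmem : ∀ t ∈ T, ∃ j, z j = t := fun t ht => by simpa [hT] using ht
  have hzT : ∀ j, z j ∈ T := fun j => by simp [hT]
  set G : ℝ → EReal := fun t => if t ∈ T then ((c - ∑ i, r i * k (t - x i) : ℝ) : EReal) else ⊥
    with hG
  have hGT : ∀ t ∈ T, G t = ((c - ∑ i, r i * k (t - x i) : ℝ) : EReal) := fun t ht => by
    simp only [hG, if_pos ht]
  have hGT' : ∀ t, t ∉ T → G t = ⊥ := fun t ht => by simp only [hG, if_neg ht]
  have hGtop : ∀ t, G t ≠ ⊤ := fun t => by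
    by_cases ht : t ∈ T
    · rw [hGT t ht]; exact EReal.coe_ne_top _
    · rw [hGT' t ht]; simp
  have hGJ : ∀ t, G t ≤ J t := fun t => by
    by_cases ht : t ∈ T
    · rw [hGT t ht]
      obtain ⟨j, rfl⟩ := hTmem t ht
      rw [← EReal.coe_toReal (hJ (z j)) (hzr j).1, EReal.coe_le_coe_iff]
      linarith [(hzr j).2.2]
    · rw [hGT' t ht]; simp
  have hGx : ∀ j, sumTrans r K G x (z j) = c := fun j => by
    rw [sumTrans_eq_coe hK.toRegKernel hx' (hz1 j) (hGtop _) (by rw [hGT _ (hzT j)]; exact EReal.coe_ne_bot _)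
      (hzr j).2.1, hGT _ (hzT j), EReal.toReal_coe, sub_add_cancel]
  have hGx' : ∀ t ∈ Icc (0:ℝ) 1, sumTrans r K G x t ≤ c := fun t _ => by
    by_cases ht : t ∈ T
    · obtain ⟨j, rfl⟩ := hTmem t ht
      exact (hGx j).le
    · rw [sumTrans, hGT' t ht, EReal.bot_add]; simp
  obtain ⟨w, hw, V, hmax, heq, hmin⟩ := hK.exists_equioscillation (r := r) (J := G) hneg hpos hr
    hGtop ((upperSemicontinuous_ite_mem_finset T _).upperSemicontinuousOn _) fun y hy => by
      obtain ⟨t, ht, hne⟩ := exists_ne_node hTcard y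
      obtain ⟨j, rfl⟩ := hTmem t ht
      exact ⟨z j, hz1 j, (sumTrans_ne_bot_iff hK.toRegKernel hr hy.2 (hz1 j) (hGtop _)).2
        ⟨by rw [hGT _ (hzT j)]; exact EReal.coe_ne_bot _, hne⟩⟩
  have hwo : w ∈ openSimplex n := mem_openSimplex_of_forall_ne_bot hK.toRegKernel hr hGtop hw
    fun j => by
      obtain ⟨t, ht, hV⟩ := heq j
      exact ⟨t, ht, ((EReal.bot_lt_coe V).trans_le hV).ne'⟩
  have hxw : x = w := le_antisymm
    (hK.le_of_equioscillation hr hGtop hx hwo (fun j => ⟨z j, hz j, (hGx j).ge⟩) hGx' heq hmax)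
    (hK.le_of_equioscillation hr hGtop hwo hx heq hmax (fun j => ⟨z j, hz j, (hGx j).ge⟩) hGx')
  have hcV : (c : EReal) ≤ V := by
    rw [← hGx 0, hxw]
    exact hmax _ (hz1 0)
  obtain ⟨t, ht, hV⟩ := hmin y hy
  exact ⟨t, ht, hcV.trans (hV.trans (add_le_add_left (hGJ t) _))⟩

lemma strictConcaveOn_perturbation_pos {ε : ℝ} (hε : 0 < ε) :
    StrictConcaveOn ℝ (Ioo (0:ℝ) 1) fun t => ε * (2 * |t| - t ^ 2) := by
  refine ⟨convex_Ioo _ _, fun x hx y hy hxy a b ha hb hab => ?_⟩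
  have h0 : 0 < a • x + b • y := add_pos (mul_pos ha hx.1) (mul_pos hb hy.1)
  simp only [smul_eq_mul] at h0 ⊢
  rw [abs_of_pos hx.1, abs_of_pos hy.1, abs_of_pos h0]
  have e : ε * (2 * (a * x + b * y) - (a * x + b * y) ^ 2) - (a * (ε * (2 * x - x ^ 2)) +
      b * (ε * (2 * y - y ^ 2))) = ε * (a * b * (x - y) ^ 2) := by
    obtain rfl : b = 1 - a := by linarith
    ring
  have : 0 < ε * (a * b * (x - y) ^ 2) := by
    have := sub_ne_zero.2 hxy
    positivity
  linarith

lemma strictConcaveOn_perturbation_neg {ε : ℝ} (hε : 0 < ε) :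
    StrictConcaveOn ℝ (Ioo (-1:ℝ) 0) fun t => ε * (2 * |t| - t ^ 2) := by
  refine ⟨convex_Ioo _ _, fun x hx y hy hxy a b ha hb hab => ?_⟩
  have h0 : a • x + b • y < 0 := add_neg (mul_neg_of_pos_of_neg ha hx.2)
    (mul_neg_of_pos_of_neg hb hy.2)
  simp only [smul_eq_mul] at h0 ⊢
  rw [abs_of_neg hx.2, abs_of_neg hy.2, abs_of_neg h0]
  have e : ε * (2 * -(a * x + b * y) - (a * x + b * y) ^ 2) - (a * (ε * (2 * -x - x ^ 2)) +
      b * (ε * (2 * -y - y ^ 2))) = ε * (a * b * (x - y) ^ 2) := by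
    obtain rfl : b = 1 - a := by linarith
    ring
  have : 0 < ε * (a * b * (x - y) ^ 2) := by
    have := sub_ne_zero.2 hxy
    positivity
  linarith

/-- Adding a small strictly concave function makes a regular kernel strictly monotone. -/
lemma RegKernel.perturb (hK : RegKernel K k) {ε : ℝ} (hε : 0 < ε) :
    StrictRegKernel (fun t => K t + ((ε * (2 * |t| - t ^ 2) : ℝ) : EReal))
      (fun t => k t + ε * (2 * |t| - t ^ 2)) := by
  have hanti : StrictAntiOn (fun t => k t + ε * (2 * |t| - t ^ 2)) (Ioo (-1:ℝ) 0) := by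
    intro s hs t ht hst
    have h1 := hK.anti hs ht hst.le
    have h2 : 0 < ε * ((t - s) * (2 + s + t)) :=
      mul_pos hε (mul_pos (by linarith) (by linarith [hs.1, ht.1]))
    simp only [abs_of_neg hs.2, abs_of_neg ht.2]
    linarith
  have hmono : StrictMonoOn (fun t => k t + ε * (2 * |t| - t ^ 2)) (Ioo (0:ℝ) 1) := by
    intro s hs t ht hst
    have h1 := hK.mono hs ht hst.le
    have h2 : 0 < ε * ((t - s) * (2 - s - t)) :=
      mul_pos hε (mul_pos (by linarith) (by linarith [hs.2, ht.2]))
    simp only [abs_of_pos hs.1, abs_of_pos ht.1]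
    linarith
  exact
    { zero := by simp [hK.zero]
      coe := fun t ht h0 => by simp only [hK.coe t ht h0, EReal.coe_add]
      cont := by
        intro t ht
        have h1 : ContinuousWithinAt (fun t : ℝ => ((ε * (2 * |t| - t ^ 2) : ℝ) : EReal))
            (Icc (-1) 1) t :=
          (continuous_coe_real_ereal.comp (by fun_prop)).continuousWithinAt
        exact (EReal.continuousAt_add (p := (K t, ((ε * (2 * |t| - t ^ 2) : ℝ) : EReal)))
          (.inr (EReal.coe_ne_bot _)) (.inr (EReal.coe_ne_top _))).tendsto.comp
          ((hK.cont t ht).prodMk_nhds h1)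
      concave_neg := hK.concave_neg.add (strictConcaveOn_perturbation_neg hε).concaveOn
      concave_pos := hK.concave_pos.add (strictConcaveOn_perturbation_pos hε).concaveOn
      anti := hanti.antitoneOn
      mono := hmono.monotoneOn
      strictAnti := hanti
      strictMono := hmono }

lemma le_sumTrans_perturb (hK : RegKernel K k) (hr : ∀ i, 0 < r i) (hJ : ∀ t, J t ≠ ⊤) {ε : ℝ}
    (hε : 0 < ε) {y : Fin n → ℝ} {t V : ℝ} (hy : ∀ i, y i ∈ Icc (0:ℝ) 1) (ht : t ∈ Icc (0:ℝ) 1)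
    (h : (V : EReal) ≤ sumTrans r K J y t) :
    (V : EReal) ≤ sumTrans r (fun t => K t + ((ε * (2 * |t| - t ^ 2) : ℝ) : EReal)) J y t := by
  rw [le_sumTrans_iff hK hr hy ht (hJ t)] at h
  rw [le_sumTrans_iff (hK.perturb hε).toRegKernel hr hy ht (hJ t)]
  refine ⟨h.1, h.2.1, h.2.2.trans (add_le_add_right (Finset.sum_le_sum fun i _ =>
    mul_le_mul_of_nonneg_left ?_ (hr i).le) _)⟩
  have h1 := abs_le.2 (sub_mem_of_mem (hy i) ht)
  have h2 : 0 ≤ ε * (2 * |t - y i| - (t - y i) ^ 2) := by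
    rw [← sq_abs]
    exact mul_nonneg hε.le (by nlinarith [abs_nonneg (t - y i)])
  linarith

lemma sub_le_sumTrans_of_le_perturb (hK : RegKernel K k) (hr : ∀ i, 0 < r i)
    (hJ : ∀ t, J t ≠ ⊤) {ε : ℝ} (hε : 0 < ε) {y : Fin n → ℝ} {t V : ℝ}
    (hy : ∀ i, y i ∈ Icc (0:ℝ) 1) (ht : t ∈ Icc (0:ℝ) 1)
    (h : (V : EReal) ≤
      sumTrans r (fun t => K t + ((ε * (2 * |t| - t ^ 2) : ℝ) : EReal)) J y t) :
    ((V - ε * ∑ i, r i : ℝ) : EReal) ≤ sumTrans r K J y t := by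
  rw [le_sumTrans_iff (hK.perturb hε).toRegKernel hr hy ht (hJ t)] at h
  rw [le_sumTrans_iff hK hr hy ht (hJ t)]
  refine ⟨h.1, h.2.1, ?_⟩
  have : ∑ i, r i * (k (t - y i) + ε * (2 * |t - y i| - (t - y i) ^ 2)) ≤
      ∑ i, (r i * k (t - y i) + ε * r i) := by
    refine Finset.sum_le_sum fun i _ => ?_
    have h2 : 2 * |t - y i| - (t - y i) ^ 2 ≤ 1 := by
      rw [← sq_abs]
      nlinarith [sq_nonneg (|t - y i| - 1)]
    nlinarith [mul_le_mul_of_nonneg_left h2 (mul_pos hε (hr i)).le]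
  rw [Finset.sum_add_distrib, ← Finset.mul_sum] at this
  linarith [h.2.2]

lemma exists_pos_mul_le {η R : ℝ} (hη : 0 < η) (hR : 0 ≤ R) : ∃ ε : ℝ, 0 < ε ∧ ε * R ≤ η := by
  refine ⟨η / (R + 1), by positivity, ?_⟩
  rw [div_mul_eq_mul_div, div_le_iff₀ (by positivity)]
  nlinarith

/-- The sandwich property for regular kernels. -/
lemma RegKernel.sandwich (hK : RegKernel K k) (hr : ∀ i, 0 < r i) (hJ : ∀ t, J t ≠ ⊤)
    {x y : Fin n → ℝ} (hx : x ∈ openSimplex n) (hy : y ∈ closedSimplex n) {c c' : ℝ}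
    (hc : ∀ j, ∃ z ∈ nodeInterval x j, (c : EReal) ≤ sumTrans r K J x z) (hcc : c' < c) :
    ∃ t ∈ Icc (0:ℝ) 1, (c' : EReal) ≤ sumTrans r K J y t := by
  have hx' := (openSimplex_subset_closedSimplex hx).2
  obtain ⟨ε, hε, hεR⟩ := exists_pos_mul_le (sub_pos.2 hcc)
    (Finset.sum_nonneg fun i (_ : i ∈ Finset.univ) => (hr i).le)
  obtain ⟨t, ht, hV⟩ := (hK.perturb hε).sandwich
    (hK.concave_neg.add_strictConcaveOn (strictConcaveOn_perturbation_neg hε))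
    (hK.concave_pos.add_strictConcaveOn (strictConcaveOn_perturbation_pos hε))
    hr hJ hx hy fun j => by
      obtain ⟨z, hz, h⟩ := hc j
      exact ⟨z, hz, le_sumTrans_perturb hK hr hJ hε hx' (nodeInterval_subset hx' j hz) h⟩
  refine ⟨t, ht, le_trans ?_ (sub_le_sumTrans_of_le_perturb hK hr hJ hε hy.2 ht hV)⟩
  rw [EReal.coe_le_coe_iff]
  linarith

lemma continuous_natNode (j : ℕ) : Continuous fun y : Fin n → ℝ => natNode y j := by
  unfold natNode
  split_ifs <;> fun_prop

lemma RegKernel.exists_approx_equioscillation (hK : RegKernel K k) (hr : ∀ i, 0 < r i)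
    (hJ : ∀ t, J t ≠ ⊤) (hJu : UpperSemicontinuousOn J (Icc (0:ℝ) 1))
    (hfin : ∀ y ∈ closedSimplex n, ∃ t ∈ Icc (0:ℝ) 1, sumTrans r K J y t ≠ ⊥)
    {w₀ : Fin n → ℝ} (hw₀ : w₀ ∈ closedSimplex n) {V : ℝ}
    (hmax : ∀ t ∈ Icc (0:ℝ) 1, sumTrans r K J w₀ t ≤ V)
    (hmin : ∀ y ∈ closedSimplex n, ∃ t ∈ Icc (0:ℝ) 1, (V : EReal) ≤ sumTrans r K J y t)
    {η : ℝ} (hη : 0 < η) :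
    ∃ w ∈ closedSimplex n, (∀ t ∈ Icc (0:ℝ) 1, sumTrans r K J w t ≤ ((V + η : ℝ) : EReal)) ∧
      ∀ j, ∃ t ∈ nodeInterval w j, ((V - η : ℝ) : EReal) ≤ sumTrans r K J w t := by
  obtain ⟨ε, hε, hεR⟩ := exists_pos_mul_le hη
    (Finset.sum_nonneg fun i (_ : i ∈ Finset.univ) => (hr i).le)
  have hup : ∀ y ∈ closedSimplex n, ∀ t ∈ Icc (0:ℝ) 1, ∀ B : ℝ,
      sumTrans r (fun t => K t + ((ε * (2 * |t| - t ^ 2) : ℝ) : EReal)) J y t ≤ B →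
      sumTrans r K J y t ≤ B := fun y hy t ht B hB => by
    by_contra! h
    obtain ⟨C, h1, h2⟩ := EReal.exists_between_coe_real h
    exact h1.not_ge ((le_sumTrans_perturb hK hr hJ hε hy.2 ht h2.le).trans hB)
  obtain ⟨w, hw, U, hU, heq, hUmin⟩ := (hK.perturb hε).exists_equioscillation
    (hK.concave_neg.add_strictConcaveOn (strictConcaveOn_perturbation_neg hε))
    (hK.concave_pos.add_strictConcaveOn (strictConcaveOn_perturbation_pos hε))
    hr hJ hJu fun y hy => by
      obtain ⟨t, ht, h⟩ := hfin y hy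
      rw [sumTrans_ne_bot_iff hK hr hy.2 ht (hJ t)] at h
      exact ⟨t, ht, (sumTrans_ne_bot_iff (hK.perturb hε).toRegKernel hr hy.2 ht (hJ t)).2 h⟩
  have hVU : V ≤ U := by
    obtain ⟨t, ht, h⟩ := hmin w hw
    rw [← EReal.coe_le_coe_iff]
    exact h.trans (hup w hw t ht U (hU t ht))
  have hUV : U ≤ V + η := by
    obtain ⟨t, ht, h⟩ := hUmin w₀ hw₀
    have := (sub_le_sumTrans_of_le_perturb hK hr hJ hε hw₀.2 ht h).trans (hmax t ht)
    rw [EReal.coe_le_coe_iff] at this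
    linarith
  refine ⟨w, hw, fun t ht => (hup w hw t ht U (hU t ht)).trans (EReal.coe_le_coe_iff.2 hUV),
    fun j => ?_⟩
  obtain ⟨t, ht, h⟩ := heq j
  refine ⟨t, ht, le_trans (EReal.coe_le_coe_iff.2 ?_)
    (sub_le_sumTrans_of_le_perturb hK hr hJ hε hw.2 (nodeInterval_subset hw.2 j ht) h)⟩
  linarith

/-- Existence of an equioscillating node system for regular kernels. -/
lemma RegKernel.exists_equioscillation (hK : RegKernel K k) (hr : ∀ i, 0 < r i)
    (hJ : ∀ t, J t ≠ ⊤) (hJu : UpperSemicontinuousOn J (Icc (0:ℝ) 1))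
    (hfin : ∀ y ∈ closedSimplex n, ∃ t ∈ Icc (0:ℝ) 1, sumTrans r K J y t ≠ ⊥) :
    ∃ w ∈ closedSimplex n, ∃ V : ℝ, (∀ t ∈ Icc (0:ℝ) 1, sumTrans r K J w t ≤ V) ∧
      ∀ j, ∃ t ∈ nodeInterval w j, (V : EReal) ≤ sumTrans r K J w t := by
  obtain ⟨w₀, hw₀, V, hmax, hmin⟩ := exists_minimax hK hr hJ hJu hfin
  have happ : ∀ m : ℕ, ∃ w ∈ closedSimplex n,
      (∀ t ∈ Icc (0:ℝ) 1, sumTrans r K J w t ≤ ((V + 1 / ((m : ℝ) + 1) : ℝ) : EReal)) ∧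
      ∀ j, ∃ t ∈ nodeInterval w j, ((V - 1 / ((m : ℝ) + 1) : ℝ) : EReal) ≤ sumTrans r K J w t :=
    fun m => hK.exists_approx_equioscillation hr hJ hJu hfin hw₀ hmax hmin (by positivity)
  choose w hw hwmax t ht htV using happ
  obtain ⟨⟨w', t'⟩, ⟨hw', ht'⟩, φ, hφ, hlim⟩ :=
    ((closedSimplex_isCompact n).prod (isCompact_univ_pi fun _ : Fin (n + 1) =>
      isCompact_Icc (a := (0:ℝ)) (b := 1))).tendsto_subseq (x := fun m => (w m, t m))
      fun m => ⟨hw m, fun j _ => nodeInterval_subset (hw m).2 j (ht m j)⟩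
  have hlw : Tendsto (fun m => w (φ m)) atTop (nhds w') := (continuous_fst.tendsto _).comp hlim
  have hlt : ∀ j, Tendsto (fun m => t (φ m) j) atTop (nhds (t' j)) := fun j =>
    (((continuous_apply j).comp continuous_snd).tendsto _).comp hlim
  have hη : Tendsto (fun m => 1 / ((φ m : ℝ) + 1)) atTop (nhds 0) :=
    tendsto_one_div_add_atTop_nhds_zero_nat.comp hφ.tendsto_atTop
  refine ⟨w', hw', V, fun s hs => ?_, fun j => ⟨t' j, ?_, ?_⟩⟩
  · have h1 : Tendsto (fun m => sumTrans r K J (w (φ m)) s) atTop (nhds (sumTrans r K J w' s)) :=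
      (continuousOn_sumTrans_left hK hr hJ hs w' hw'.2).tendsto.comp
        (tendsto_nhdsWithin_iff.2 ⟨hlw, Eventually.of_forall fun m => (hw _).2⟩)
    have h2 : Tendsto (fun m => ((V + 1 / ((φ m : ℝ) + 1) : ℝ) : EReal)) atTop (nhds V) := by
      have := hη.const_add V
      rw [add_zero] at this
      exact (continuous_coe_real_ereal.tendsto _).comp this
    exact le_of_tendsto_of_tendsto' h1 h2 fun m => hwmax _ s hs
  · rw [mem_nodeInterval]
    have h1 := fun m => (mem_nodeInterval _ _ _).1 (ht (φ m) j)
    exact ⟨le_of_tendsto_of_tendsto' (((continuous_natNode _).tendsto _).comp hlw) (hlt j)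
      fun m => (h1 m).1, le_of_tendsto_of_tendsto' (hlt j)
      (((continuous_natNode _).tendsto _).comp hlw) fun m => (h1 m).2⟩
  · by_contra! h
    obtain ⟨C, h1, h2⟩ := EReal.exists_between_coe_real h
    rw [EReal.coe_lt_coe_iff] at h2
    have hu := upperSemicontinuousOn_sumTrans (n := n) hK hr hJ hJu (w', t' j)
      ⟨hw'.2, ht' j trivial⟩ C h1
    have hl : Tendsto (fun m => (w (φ m), t (φ m) j)) atTop
        (nhdsWithin (w', t' j) ({y | ∀ i, y i ∈ Icc (0:ℝ) 1} ×ˢ Icc (0:ℝ) 1)) :=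
      tendsto_nhdsWithin_iff.2 ⟨hlw.prodMk_nhds (hlt j), Eventually.of_forall fun m =>
        ⟨(hw _).2, nodeInterval_subset (hw _).2 j (ht _ j)⟩⟩
    obtain ⟨m, hm, hm'⟩ := ((hl.eventually hu).and
      (hη.eventually_lt_const (sub_pos.2 h2))).exists
    have := (htV (φ m) j).trans_lt hm
    rw [EReal.coe_lt_coe_iff] at this
    linarith

end

section

variable {n : ℕ} {r : Fin n → ℝ} {K J : ℝ → EReal} {k : ℝ → ℝ}

lemma IsKernel.ne_bot (hK : IsKernel K) (hmono : MonotoneKernel K) {t : ℝ}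
    (ht : t ∈ Icc (-1:ℝ) 1) (h0 : t ≠ 0) : K t ≠ ⊥ := by
  rcases ht.1.eq_or_lt with rfl | h1
  · have hle : K (-(1 / 2)) ≤ K (-1) := ge_of_tendsto hK.lim_neg_one <| by
      filter_upwards [Ioo_mem_nhdsGT (show (-1:ℝ) < -(1 / 2) by norm_num)] with x hx
      exact hmono.1 ⟨hx.1, by linarith [hx.2]⟩ (by norm_num) hx.2.le
    exact ne_bot_of_le_ne_bot (hK.finite_off_zero _ (by norm_num) (by norm_num)) hle
  rcases ht.2.eq_or_lt with rfl | h2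
  · have hle : K (1 / 2) ≤ K 1 := ge_of_tendsto hK.lim_one <| by
      filter_upwards [Ioo_mem_nhdsLT (show (1 / 2 : ℝ) < 1 by norm_num)] with x hx
      exact hmono.2 (by norm_num) ⟨by linarith [hx.1], hx.2⟩ hx.1.le
    exact ne_bot_of_le_ne_bot (hK.finite_off_zero _ (by norm_num) (by norm_num)) hle
  · exact hK.finite_off_zero t ⟨h1, h2⟩ h0

lemma IsKernel.continuousAt_of_mem (hK : IsKernel K) {s : Set ℝ} (hs : IsOpen s)
    (hsub : s ⊆ Ioo (-1) 1) (h0 : (0:ℝ) ∉ s) (hc : ConcaveOn ℝ s fun t => (K t).toReal)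
    {t : ℝ} (ht : t ∈ s) : ContinuousAt K t := by
  have h1 := (hc.continuousOn hs).continuousAt (hs.mem_nhds ht)
  refine ContinuousAt.congr (continuous_coe_real_ereal.continuousAt.comp h1) ?_
  filter_upwards [hs.mem_nhds ht] with x hx
  exact EReal.coe_toReal (hK.ne_top x) (hK.finite_off_zero x (hsub hx) (fun h => h0 (h ▸ hx)))

lemma IsKernel.continuousOn (hK : IsKernel K) : ContinuousOn K (Icc (-1) 1) := by
  intro t ht
  rcases ht.1.eq_or_lt with rfl | h1
  · exact (continuousWithinAt_Ioi_iff_Ici.1 hK.lim_neg_one).mono Icc_subset_Ici_self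
  rcases ht.2.eq_or_lt with rfl | h2
  · exact (continuousWithinAt_Iio_iff_Iic.1 hK.lim_one).mono Icc_subset_Iic_self
  refine ContinuousAt.continuousWithinAt ?_
  rcases lt_trichotomy t 0 with h0 | rfl | h0
  · exact hK.continuousAt_of_mem isOpen_Ioo (Ioo_subset_Ioo_right zero_le_one) (by simp)
      hK.concave_neg ⟨h1, h0⟩
  · exact continuousAt_iff_continuous_left'_right'.2 ⟨hK.lim_zero_left, hK.lim_zero_right⟩
  · exact hK.continuousAt_of_mem isOpen_Ioo (Ioo_subset_Ioo_left (by norm_num)) (by simp)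
      hK.concave_pos ⟨h0, h2⟩

lemma IsKernel.regKernel (hK : IsKernel K) (hsing : SingularKernel K) (hmono : MonotoneKernel K) :
    RegKernel K fun t => (K t).toReal where
  zero := hsing
  coe t ht h0 := (EReal.coe_toReal (hK.ne_top t) (hK.ne_bot hmono ht h0)).symm
  cont := hK.continuousOn
  concave_neg := hK.concave_neg
  concave_pos := hK.concave_pos
  anti _ hs t ht hst := EReal.toReal_le_toReal (hmono.1 hs ht hst)
    (hK.finite_off_zero t ⟨ht.1, ht.2.trans zero_lt_one⟩ ht.2.ne) (hK.ne_top _)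
  mono s hs _ ht hst := EReal.toReal_le_toReal (hmono.2 hs ht hst)
    (hK.finite_off_zero s ⟨by linarith [hs.1], hs.2⟩ hs.1.ne') (hK.ne_top _)

lemma IsKernel.toReal_lt_toReal (hK : IsKernel K) {s t : ℝ} (hs : s ∈ Ioo (-1:ℝ) 1) (hs0 : s ≠ 0)
    (h : K s < K t) : (K s).toReal < (K t).toReal := by
  rwa [← EReal.coe_lt_coe_iff, EReal.coe_toReal (hK.ne_top s) (hK.finite_off_zero s hs hs0),
    EReal.coe_toReal (hK.ne_top t) (bot_le.trans_lt h).ne']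

lemma IsKernel.strictRegKernel (hK : IsKernel K) (hsing : SingularKernel K)
    (hmono : MonotoneKernel K) (hstrict : StrictMonotoneKernel K) :
    StrictRegKernel K fun t => (K t).toReal where
  toRegKernel := hK.regKernel hsing hmono
  strictAnti s hs t ht hst := hK.toReal_lt_toReal ⟨ht.1, ht.2.trans zero_lt_one⟩ ht.2.ne
    (hstrict.1 ⟨hs.1.le, hs.2⟩ ⟨ht.1.le, ht.2⟩ hst)
  strictMono s hs t ht hst := hK.toReal_lt_toReal ⟨by linarith [hs.1], hs.2⟩ hs.1.ne'
    (hstrict.2 ⟨hs.1, hs.2.le⟩ ⟨ht.1, ht.2.le⟩ hst)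

lemma IsFieldFn.exists_sumTrans_ne_bot (hJ : IsFieldFn n J) (hK : RegKernel K k)
    (hr : ∀ i, 0 < r i) {y : Fin n → ℝ} (hy : y ∈ closedSimplex n) :
    ∃ t ∈ Icc (0:ℝ) 1, sumTrans r K J y t ≠ ⊥ := by
  obtain ⟨htop, -, T, hT, hTb, hcard⟩ := hJ
  have h1 : ∑ t ∈ T, (if t = 0 ∨ t = 1 then (1/2 : ℝ) else 1) ≤ ∑ t ∈ T, 1 :=
    Finset.sum_le_sum fun t _ => by split_ifs <;> norm_num
  have h2 : n < T.card := by
    have := hcard.trans_le h1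
    simp only [Finset.sum_const, nsmul_eq_mul, mul_one] at this
    exact_mod_cast this
  obtain ⟨t, ht, hne⟩ := exists_ne_node h2 y
  exact ⟨t, hT ht, (sumTrans_ne_bot_iff hK hr hy.2 (hT ht) (htop t)).2 ⟨hTb t ht, hne⟩⟩

lemma exists_mj_eq (hK : RegKernel K k) (hr : ∀ i, 0 < r i)
    (hJ : ∀ t, J t ≠ ⊤) (hJu : UpperSemicontinuousOn J (Icc (0:ℝ) 1)) {y : Fin n → ℝ}
    (hy : y ∈ closedSimplex n) (j : Fin (n + 1)) :
    ∃ t ∈ nodeInterval y j, mj r K J j y = sumTrans r K J y t := by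
  have hne : (nodeInterval y j).Nonempty :=
    ⟨natNode y j, (mem_nodeInterval _ _ _).2 ⟨le_rfl, natNode_le_succ hy j⟩⟩
  obtain ⟨t, ht, hm⟩ := ((upperSemicontinuousOn_sumTrans_right hK hr hJ hJu hy.2).mono
    (nodeInterval_subset hy.2 j)).exists_isMaxOn hne isCompact_Icc
  exact ⟨t, ht, le_antisymm (sSup_le (forall_mem_image.2 fun s hs => hm hs))
    (le_sSup (mem_image_of_mem _ ht))⟩

lemma sumTrans_le_mj {y : Fin n → ℝ} {j : Fin (n + 1)} {t : ℝ} (ht : t ∈ nodeInterval y j) :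
    sumTrans r K J y t ≤ mj r K J j y := le_sSup (mem_image_of_mem _ ht)

lemma sumTrans_le_mbar {y : Fin n → ℝ} {t : ℝ} (ht : t ∈ Icc (0:ℝ) 1) :
    sumTrans r K J y t ≤ mbar r K J y := by
  obtain ⟨j, hj⟩ := exists_mem_nodeInterval y ht
  exact (sumTrans_le_mj hj).trans (le_iSup (fun j => mj r K J j y) j)

lemma munder_le_mbar (hK : RegKernel K k) (hr : ∀ i, 0 < r i)
    (hJ : ∀ t, J t ≠ ⊤) (hJu : UpperSemicontinuousOn J (Icc (0:ℝ) 1)) {x y : Fin n → ℝ}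
    (hx : x ∈ openSimplex n) (hy : y ∈ closedSimplex n) :
    munder r K J x ≤ mbar r K J y := by
  by_contra! h
  obtain ⟨c', h1, h2⟩ := EReal.exists_between_coe_real h
  obtain ⟨c, h3, h4⟩ := EReal.exists_between_coe_real h2
  obtain ⟨t, ht, hc⟩ := hK.sandwich hr hJ hx hy (c := c) (c' := c') (fun j => by
    obtain ⟨z, hz, e⟩ := exists_mj_eq hK hr hJ hJu (openSimplex_subset_closedSimplex hx) j
    exact ⟨z, hz, e ▸ h4.le.trans (iInf_le (fun j => mj r K J j x) j)⟩) (EReal.coe_lt_coe_iff.1 h3)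
  exact h1.not_ge (hc.trans (sumTrans_le_mbar ht))

end

theorem statement10 (n : ℕ) (hn : 0 < n) (r : Fin n → ℝ) (hr : ∀ j, 0 < r j)
    (K J : ℝ → EReal) (hK : IsKernel K)
    (hsing : SingularKernel K) (hmono : MonotoneKernel K)
    (hJ : IsFieldFn n J) (hJusc : UpperSemicontinuousOn J (Icc (0:ℝ) 1)) :
    (⨅ x ∈ openSimplex n, mbar r K J x) = (⨆ x ∈ openSimplex n, munder r K J x) ∧
    ∃ w ∈ regSet r K J, Equioscillation r K J w ∧
      munder r K J w = (⨆ x ∈ openSimplex n, munder r K J x) ∧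
      mbar r K J w = (⨅ x ∈ openSimplex n, mbar r K J x) ∧
      (∀ x ∈ openSimplex n,
        munder r K J x ≤ (⨅ x' ∈ openSimplex n, mbar r K J x') ∧
        (⨆ x' ∈ openSimplex n, munder r K J x') ≤ mbar r K J x) ∧
      (∀ w' ∈ closedSimplex n, Equioscillation r K J w' →
        ∀ j, mj r K J j w' = (⨅ x' ∈ openSimplex n, mbar r K J x')) ∧
      (StrictMonotoneKernel K →
        ∀ w' ∈ closedSimplex n, Equioscillation r K J w' → w' = w) := by
  have hreg := hK.regKernel hsing hmono
  have htop := hJ.1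
  have hfin : ∀ y ∈ closedSimplex n, ∃ t ∈ Icc (0:ℝ) 1, sumTrans r K J y t ≠ ⊥ :=
    fun y hy => hJ.exists_sumTrans_ne_bot hreg hr hy
  obtain ⟨w, hw, V, hmax, heq⟩ := hreg.exists_equioscillation hr htop hJusc hfin
  have hwo : w ∈ openSimplex n := mem_openSimplex_of_forall_ne_bot hreg hr htop hw fun j => by
    obtain ⟨t, ht, hV⟩ := heq j
    exact ⟨t, ht, ((EReal.bot_lt_coe V).trans_le hV).ne'⟩
  have hmj : ∀ j, mj r K J j w = V := fun j => by
    obtain ⟨t, ht, hV⟩ := heq j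
    exact le_antisymm (sSup_le (forall_mem_image.2 fun s hs =>
      hmax s (nodeInterval_subset hw.2 j hs))) (hV.trans (sumTrans_le_mj ht))
  have hunder : munder r K J w = V := by simp only [munder, hmj, iInf_const]
  have hbar : mbar r K J w = V := by simp only [mbar, hmj, iSup_const]
  have hsand : ∀ x ∈ openSimplex n, ∀ y ∈ closedSimplex n, munder r K J x ≤ mbar r K J y :=
    fun x hx y hy => munder_le_mbar hreg hr htop hJusc hx hy
  have hinf : (⨅ x ∈ openSimplex n, mbar r K J x) = V :=
    le_antisymm (hbar ▸ iInf₂_le w hwo) (le_iInf₂ fun x hx =>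
      hunder ▸ hsand w hwo x (openSimplex_subset_closedSimplex hx))
  have hsup : (⨆ x ∈ openSimplex n, munder r K J x) = V :=
    le_antisymm (iSup₂_le fun x hx => hbar ▸ hsand x hx w hw)
      (hunder ▸ le_iSup₂ (f := fun x (_ : x ∈ openSimplex n) => munder r K J x) w hwo)
  have hvalue : ∀ w' ∈ closedSimplex n, Equioscillation r K J w' →
      w' ∈ openSimplex n ∧ ∀ j, mj r K J j w' = V := fun w' hw' he => by
    obtain ⟨t, ht, hb⟩ := hfin w' hw'
    obtain ⟨i, hi⟩ := exists_mem_nodeInterval w' ht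
    have hwo' : w' ∈ openSimplex n :=
      mem_openSimplex_of_forall_ne_bot hreg hr htop hw' fun j => by
        obtain ⟨s, hs, e⟩ := exists_mj_eq hreg hr htop hJusc hw' j
        exact ⟨s, hs, e ▸ he i j ▸ ne_bot_of_le_ne_bot hb (sumTrans_le_mj hi)⟩
    have hm : ∀ j, mj r K J j w' = mj r K J 0 w' := fun j => he j 0
    have hunder' : munder r K J w' = mj r K J 0 w' := by
      rw [munder, iInf_congr hm, iInf_const]
    have hbar' : mbar r K J w' = mj r K J 0 w' := by
      rw [mbar, iSup_congr hm, iSup_const]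
    refine ⟨hwo', fun j => (hm j).trans (le_antisymm ?_ ?_)⟩
    · rw [← hunder', ← hbar]; exact hsand w' hwo' w hw
    · rw [← hbar', ← hunder]; exact hsand w hwo w' hw'
  rw [hinf, hsup]
  refine ⟨rfl, w, ⟨hwo, fun j => by rw [hmj j]; exact EReal.coe_ne_bot V⟩,
    fun i j => (hmj i).trans (hmj j).symm, hunder, hbar, fun x hx => ⟨?_, ?_⟩,
    fun w' hw' he => (hvalue w' hw' he).2, fun hstrict w' hw' he => ?_⟩
  · rw [← hbar]; exact hsand x hx w hw
  · rw [← hunder]; exact hsand w hwo x (openSimplex_subset_closedSimplex hx)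
  · obtain ⟨hwo', hmj'⟩ := hvalue w' hw' he
    have hs := hK.strictRegKernel hsing hmono hstrict
    have heq' : ∀ j, ∃ z ∈ nodeInterval w' j, (V : EReal) ≤ sumTrans r K J w' z := fun j => by
      obtain ⟨z, hz, e⟩ := exists_mj_eq hreg hr htop hJusc hw' j
      exact ⟨z, hz, by rw [← e, hmj' j]⟩
    have hmax' : ∀ t ∈ Icc (0:ℝ) 1, sumTrans r K J w' t ≤ V := fun t ht => by
      obtain ⟨j, hj⟩ := exists_mem_nodeInterval w' ht
      exact (sumTrans_le_mj hj).trans (hmj' j).le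
    exact le_antisymm (hs.le_of_equioscillation hr htop hwo' hwo heq' hmax' heq hmax)
      (hs.le_of_equioscillation hr htop hwo hwo' heq hmax heq' hmax')
end
end

section
/- Let n ∈ ℕ and let x = (x₁,…,xₙ) and y = (y₁,…,yₙ) be two distinct node systems with 0 < x₁ < ⋯ < xₙ < 1 and 0 < y₁ < ⋯ < yₙ < 1. With the convention x₀ := 0, x_{n+1} := 1 (and likewise for y), there exist indices i ≠ j in {0,1,…,n} such that max_{t ∈ [x_i, x_{i+1}]} ∏_{k=1}^n |t − x_k| < max_{t ∈ [y_i, y_{i+1}]} ∏_{k=1}^n |t − y_k| and max_{t ∈ [x_j, x_{j+1}]} ∏_{k=1}^n |t − x_k| > max_{t ∈ [y_j, y_{j+1}]} ∏_{k=1}^n |t − y_k|. -/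
open Set Filter

noncomputable section

/-- The absolute value of the monic polynomial with node system `x`. -/
def chebyAbs {n : ℕ} (x : Fin n → ℝ) (t : ℝ) : ℝ := ∏ k, |t - x k|

lemma mem_nodeInterval_iff {n : ℕ} {x : Fin n → ℝ} (hx : StrictMono x)
    (hx' : ∀ k, x k ∈ Ioo (0:ℝ) 1) {i : Fin (n + 1)} {t : ℝ} :
    t ∈ nodeInterval x i ↔ (0 ≤ t ∧ t ≤ 1) ∧
      (∀ k : Fin n, k.castSucc < i → x k ≤ t) ∧ ∀ k : Fin n, i ≤ k.castSucc → t ≤ x k := by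
  obtain ⟨i, hi⟩ := i
  simp only [nodeInterval, extNode, mem_Icc, Fin.lt_def, Fin.le_def, Fin.val_castSucc,
    Fin.castSucc_mk, Fin.succ_mk]
  have hle : i ≤ n := by omega
  simp only [hle, dite_true, Nat.add_eq_zero_iff, one_ne_zero, and_false, dite_false,
    Nat.add_sub_cancel]
  constructor
  · rintro ⟨h1, h2⟩
    have hlow : ∀ k : Fin n, (k : ℕ) < i → x k ≤ t := by
      intro k hk
      rw [dif_neg (by omega)] at h1
      exact (hx.monotone (Fin.le_def.2 (by simp only; omega))).trans h1
    have hupp : ∀ k : Fin n, i ≤ (k : ℕ) → t ≤ x k := by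
      intro k hk
      have := k.isLt
      rw [dif_pos (by omega)] at h2
      exact h2.trans (hx.monotone (Fin.le_def.2 (by simp only; omega)))
    refine ⟨⟨?_, ?_⟩, hlow, hupp⟩
    · split_ifs at h1 with h
      · exact h1
      · exact (hx' _).1.le.trans h1
    · split_ifs at h2 with h
      · exact h2.trans (hx' _).2.le
      · exact h2
  · rintro ⟨⟨h0, h1⟩, hlow, hupp⟩
    constructor
    · split_ifs with h
      · exact h0
      · exact hlow _ (by simp only; omega)
    · split_ifs with h
      · exact hupp _ le_rfl
      · exact h1

lemma exists_node_between {n : ℕ} {x : Fin n → ℝ} (hx : StrictMono x)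
    (hx' : ∀ k, x k ∈ Ioo (0:ℝ) 1) (i : Fin (n + 1)) :
    ∃ t ∈ nodeInterval x i, ∀ k, t ≠ x k := by
  have hlt : extNode x i.castSucc < extNode x i.succ := by
    obtain ⟨i, hi⟩ := i
    have hle : i ≤ n := by omega
    simp only [extNode, Fin.castSucc_mk, Fin.succ_mk, hle, dite_true, Nat.add_eq_zero_iff,
      one_ne_zero, and_false, dite_false, Nat.add_sub_cancel]
    split_ifs
    · exact (hx' _).1
    · exact zero_lt_one
    · exact hx (Fin.lt_def.2 (by simp only; omega))
    · exact (hx' _).2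
  obtain ⟨t, ht, hne⟩ := (Ioo_infinite hlt).exists_notMem_finite (finite_range x)
  exact ⟨t, Ioo_subset_Icc_self ht, fun k hk => hne ⟨k, hk.symm⟩⟩

/-- On each node interval the maximum is attained at a point `z` off the nodes at which the
logarithmic derivative is nonpositive in every direction pointing into `[0, 1]`. -/
lemma exists_max_nodeInterval {n : ℕ} {x : Fin n → ℝ} (hx : StrictMono x)
    (hx' : ∀ k, x k ∈ Ioo (0:ℝ) 1) (i : Fin (n + 1)) :
    ∃ z ∈ Icc (0:ℝ) 1, sSup (chebyAbs x '' nodeInterval x i) = ∏ k, |z - x k| ∧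
      (∀ k : Fin n, k.castSucc < i → x k < z) ∧ (∀ k : Fin n, i ≤ k.castSucc → z < x k) ∧
      ∀ w ∈ Icc (0:ℝ) 1, (w - z) * ∑ k, (z - x k)⁻¹ ≤ 0 := by
  obtain ⟨t, ht, htne⟩ := exists_node_between hx hx' i
  have hcont : Continuous (chebyAbs x) := by unfold chebyAbs; fun_prop
  obtain ⟨z, hz, hmax⟩ := (isCompact_Icc : IsCompact (nodeInterval x i)).exists_isMaxOn
    ⟨t, ht⟩ hcont.continuousOn
  have hpos : 0 < chebyAbs x z :=
    (Finset.prod_pos fun k _ => abs_pos.2 (sub_ne_zero.2 (htne k))).trans_le (hmax ht)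
  have hne : ∀ k, z - x k ≠ 0 := fun k =>
    abs_ne_zero.1 (Finset.prod_ne_zero_iff.1 hpos.ne' k (Finset.mem_univ k))
  obtain ⟨⟨h0, h1⟩, hlow, hupp⟩ := (mem_nodeInterval_iff hx hx').1 hz
  have hlow' : ∀ k : Fin n, k.castSucc < i → x k < z := fun k hk =>
    (hlow k hk).lt_of_ne fun h => hne k (by rw [h, sub_self])
  have hupp' : ∀ k : Fin n, i ≤ k.castSucc → z < x k := fun k hk =>
    (hupp k hk).lt_of_ne fun h => hne k (by rw [h, sub_self])
  refine ⟨z, ⟨h0, h1⟩, ?_, hlow', hupp', fun w hw => ?_⟩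
  · exact IsGreatest.csSup_eq ⟨mem_image_of_mem _ hz, by rintro _ ⟨s, hs, rfl⟩; exact hmax hs⟩
  rcases h0.eq_or_lt with rfl | h0
  · refine mul_nonpos_of_nonneg_of_nonpos (by linarith [hw.1]) (Finset.sum_nonpos fun k _ => ?_)
    exact inv_nonpos.2 (by linarith [(hx' k).1])
  rcases h1.eq_or_lt with rfl | h1
  · refine mul_nonpos_of_nonpos_of_nonneg (by linarith [hw.2]) (Finset.sum_nonneg fun k _ => ?_)
    exact inv_nonneg.2 (by linarith [(hx' k).2])
  have hnear : ∀ᶠ s in nhds z, s ∈ nodeInterval x i := by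
    have hl : ∀ᶠ s in nhds z, ∀ k : Fin n, k.castSucc < i → x k ≤ s :=
      eventually_all.2 fun k => eventually_imp_distrib_left.2 fun hk =>
        (lt_mem_nhds (hlow' k hk)).mono fun _ h => le_of_lt h
    have hu : ∀ᶠ s in nhds z, ∀ k : Fin n, i ≤ k.castSucc → s ≤ x k :=
      eventually_all.2 fun k => eventually_imp_distrib_left.2 fun hk =>
        (gt_mem_nhds (hupp' k hk)).mono fun _ h => le_of_lt h
    filter_upwards [hl, hu, lt_mem_nhds h0, gt_mem_nhds h1] with s hsl hsu hs0 hs1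
    exact (mem_nodeInterval_iff hx hx').2 ⟨⟨hs0.le, hs1.le⟩, hsl, hsu⟩
  have hloc : IsLocalMax (fun s => ∑ k, Real.log (s - x k)) z := by
    have hne' : ∀ᶠ s in nhds z, chebyAbs x s ≠ 0 := hcont.continuousAt.eventually_ne hpos.ne'
    have hlog : ∀ s, chebyAbs x s ≠ 0 →
        ∑ k, Real.log (s - x k) = Real.log (chebyAbs x s) := by
      intro s hs
      rw [chebyAbs, Real.log_prod fun k hk => Finset.prod_ne_zero_iff.1 hs k hk]
      simp only [Real.log_abs]
    filter_upwards [hnear, hne'] with s hs hsne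
    rw [hlog s hsne, hlog z hpos.ne']
    exact Real.log_le_log
      ((Finset.prod_nonneg fun k _ => abs_nonneg _ : 0 ≤ chebyAbs x s).lt_of_ne' hsne) (hmax hs)
  have hderiv : HasDerivAt (fun s => ∑ k, Real.log (s - x k)) (∑ k, (z - x k)⁻¹) z := by
    refine HasDerivAt.fun_sum fun k _ => ?_
    simpa using ((hasDerivAt_id z).sub_const (x k)).log (hne k)
  rw [hloc.hasDerivAt_eq_zero hderiv, mul_zero]

/-- If `x` interlaces `z`, the rows of the Cauchy matrix `((z i - x k)⁻¹)` satisfy a linear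
relation with positive coefficients. -/
lemma exists_pos_cauchy_relation {n : ℕ} {x : Fin n → ℝ} {z : Fin (n + 1) → ℝ}
    (hlow : ∀ (i : Fin (n + 1)) (k : Fin n), k.castSucc < i → x k < z i)
    (hupp : ∀ (i : Fin (n + 1)) (k : Fin n), i ≤ k.castSucc → z i < x k) :
    ∃ c : Fin (n + 1) → ℝ, (∀ i, 0 < c i) ∧ ∀ k, ∑ i, c i * (z i - x k)⁻¹ = 0 := by
  have hz : StrictMono z := Fin.strictMono_iff_lt_succ.2 fun k =>
    (hupp _ k le_rfl).trans (hlow _ k Fin.castSucc_lt_succ)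
  have hne : ∀ i k, z i - x k ≠ 0 := fun i k => by
    rcases lt_or_ge k.castSucc i with h | h
    · exact sub_ne_zero.2 (hlow i k h).ne'
    · exact sub_ne_zero.2 (hupp i k h).ne
  refine ⟨fun i => (∏ k, (z i - x k)) / ∏ j ∈ Finset.univ.erase i, (z i - z j), fun i => ?_,
    fun k => ?_⟩
  · have herase : ∏ j ∈ Finset.univ.erase i, (z i - z j) = ∏ k, (z i - z (i.succAbove k)) := by
      rw [← Finset.compl_singleton, ← Fin.image_succAbove_univ,
        Finset.prod_image fun _ _ _ _ h => Fin.succAbove_right_injective h]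
    simp only [herase, ← Finset.prod_div_distrib]
    refine Finset.prod_pos fun k _ => ?_
    rcases lt_or_ge k.castSucc i with h | h
    · rw [Fin.succAbove_of_castSucc_lt _ _ h]
      exact div_pos (sub_pos.2 (hlow i k h)) (sub_pos.2 (hz h))
    · rw [Fin.succAbove_of_le_castSucc _ _ h]
      exact div_pos_of_neg_of_neg (sub_neg.2 (hupp i k h))
        (sub_neg.2 (hz (h.trans_lt Fin.castSucc_lt_succ)))
  · set P : Polynomial ℝ := ∏ l ∈ Finset.univ.erase k, (Polynomial.X - Polynomial.C (x l))
    have hdeg : P.natDegree = n - 1 := by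
      rw [Polynomial.natDegree_prod_of_monic _ _ fun l _ => Polynomial.monic_X_sub_C (x l)]
      simp
    have hkn : n - 1 < n := by have := k.isLt; omega
    have hcoeff := Lagrange.coeff_eq_sum (s := Finset.univ) (v := z) hz.injective.injOn (P := P)
      (Polynomial.degree_le_natDegree.trans_lt (by
        rw [hdeg, Finset.card_univ, Fintype.card_fin]; exact_mod_cast hkn.trans n.lt_succ_self))
    rw [Finset.card_univ, Fintype.card_fin, Nat.add_sub_cancel,
      Polynomial.coeff_eq_zero_of_natDegree_lt (hdeg.trans_lt hkn)] at hcoeff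
    rw [hcoeff]
    refine Finset.sum_congr rfl fun i _ => ?_
    have heval : P.eval (z i) = ∏ l ∈ Finset.univ.erase k, (z i - x l) := by
      simp [P, Polynomial.eval_prod]
    beta_reduce
    rw [heval, ← Finset.mul_prod_erase _ _ (Finset.mem_univ k)]
    field_simp [hne i k]

lemma eq_one_of_one_le_prod_of_sum_sub_one_nonpos {ι : Type*} [Fintype ι] {r : ι → ℝ}
    (hr : ∀ k, 0 < r k) (hprod : 1 ≤ ∏ k, r k) (hsum : ∑ k, (r k - 1) ≤ 0) (k : ι) :
    r k = 1 := by
  by_contra hk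
  have hlt : ∑ k, Real.log (r k) < ∑ k, (r k - 1) :=
    Finset.sum_lt_sum (fun k _ => Real.log_le_sub_one_of_pos (hr k))
      ⟨k, Finset.mem_univ k, Real.log_lt_sub_one_of_pos (hr k) hk⟩
  rw [← Real.log_prod fun k _ => (hr k).ne'] at hlt
  linarith [Real.log_nonneg hprod]

lemma exists_prod_abs_lt_prod_abs {n : ℕ} (hn : 0 < n) {x y : Fin n → ℝ}
    {z w : Fin (n + 1) → ℝ} (hxy : x ≠ y)
    (hxlow : ∀ (i : Fin (n + 1)) (k : Fin n), k.castSucc < i → x k < z i)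
    (hxupp : ∀ (i : Fin (n + 1)) (k : Fin n), i ≤ k.castSucc → z i < x k)
    (hylow : ∀ (i : Fin (n + 1)) (k : Fin n), k.castSucc < i → y k < w i)
    (hyupp : ∀ (i : Fin (n + 1)) (k : Fin n), i ≤ k.castSucc → w i < y k)
    (hcrit : ∀ i, (w i - z i) * ∑ k, (z i - x k)⁻¹ ≤ 0) :
    ∃ i, ∏ k, |w i - y k| < ∏ k, |z i - x k| := by
  have : Nonempty (Fin n) := ⟨⟨0, hn⟩⟩
  by_contra! hle
  obtain ⟨c, hc, hrel⟩ := exists_pos_cauchy_relation hxlow hxupp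
  have hne : ∀ i k, z i - x k ≠ 0 := fun i k => by
    rcases lt_or_ge k.castSucc i with h | h
    · exact sub_ne_zero.2 (hxlow i k h).ne'
    · exact sub_ne_zero.2 (hxupp i k h).ne
  have hr : ∀ i k, 0 < (w i - y k) / (z i - x k) := fun i k => by
    rcases lt_or_ge k.castSucc i with h | h
    · exact div_pos (sub_pos.2 (hylow i k h)) (sub_pos.2 (hxlow i k h))
    · exact div_pos_of_neg_of_neg (sub_neg.2 (hyupp i k h)) (sub_neg.2 (hxupp i k h))
  have hprod : ∀ i, 1 ≤ ∏ k, (w i - y k) / (z i - x k) := fun i => by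
    have hcongr : ∏ k, (w i - y k) / (z i - x k) = (∏ k, |w i - y k|) / ∏ k, |z i - x k| := by
      rw [← Finset.prod_div_distrib]
      exact Finset.prod_congr rfl fun k _ => by rw [← abs_div, abs_of_pos (hr i k)]
    rw [hcongr, one_le_div (Finset.prod_pos fun k _ => abs_pos.2 (hne i k))]
    exact hle i
  have hsum : ∀ i, ∑ k, ((w i - y k) / (z i - x k) - 1) =
      (w i - z i) * ∑ k, (z i - x k)⁻¹ - ∑ k, (y k - x k) * (z i - x k)⁻¹ := fun i => by
    rw [Finset.mul_sum, ← Finset.sum_sub_distrib]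
    refine Finset.sum_congr rfl fun k _ => ?_
    have := hne i k
    field_simp
    ring
  have hweighted : ∑ i, c i * ∑ k, (y k - x k) * (z i - x k)⁻¹ = 0 := by
    simp only [Finset.mul_sum]
    rw [Finset.sum_comm]
    refine Finset.sum_eq_zero fun k _ => ?_
    rw [← mul_zero (y k - x k), ← hrel k, Finset.mul_sum]
    exact Finset.sum_congr rfl fun i _ => by ring
  have hlog : ∀ i, 0 ≤ ∑ k, ((w i - y k) / (z i - x k) - 1) := fun i => by
    refine (Real.log_nonneg (hprod i)).trans ?_
    rw [Real.log_prod fun k _ => (hr i k).ne']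
    exact Finset.sum_le_sum fun k _ => Real.log_le_sub_one_of_pos (hr i k)
  have hnonpos : ∀ i, ∑ k, (y k - x k) * (z i - x k)⁻¹ ≤ 0 := fun i => by
    linarith [hlog i, hsum i, hcrit i]
  have hzero : ∀ i, ∑ k, (y k - x k) * (z i - x k)⁻¹ = 0 := fun i => by
    have h := (Finset.sum_eq_zero_iff_of_nonpos fun i _ =>
      mul_nonpos_of_nonneg_of_nonpos (hc i).le (hnonpos i)).1 hweighted i (Finset.mem_univ i)
    exact (mul_eq_zero.1 h).resolve_left (hc i).ne'
  have hshift : ∀ i k, w i - z i = y k - x k := fun i k => by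
    have h := eq_one_of_one_le_prod_of_sum_sub_one_nonpos (hr i) (hprod i)
      (by rw [hsum, hzero, sub_zero]; exact hcrit i) k
    rw [div_eq_one_iff_eq (hne i k)] at h
    linarith
  have hfirst : ∑ k, (z 0 - x k)⁻¹ < 0 := Finset.sum_neg
    (fun k _ => inv_lt_zero.2 (sub_neg.2 (hxupp 0 k (Fin.zero_le _)))) Finset.univ_nonempty
  have hlast : 0 < ∑ k, (z (Fin.last n) - x k)⁻¹ := Finset.sum_pos
    (fun k _ => inv_pos.2 (sub_pos.2 (hxlow _ k (Fin.castSucc_lt_last k)))) Finset.univ_nonempty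
  refine hxy (funext fun k => ?_)
  have h0 := hcrit 0
  have h1 := hcrit (Fin.last n)
  rw [hshift _ k] at h0 h1
  linarith [nonneg_of_mul_nonpos_left h0 hfirst, nonpos_of_mul_nonpos_left h1 hlast]

theorem statement13 (n : ℕ) (hn : 0 < n) (x y : Fin n → ℝ)
    (hx : StrictMono x) (hx' : ∀ k, x k ∈ Ioo (0:ℝ) 1)
    (hy : StrictMono y) (hy' : ∀ k, y k ∈ Ioo (0:ℝ) 1)
    (hxy : x ≠ y) :
    ∃ i j : Fin (n + 1), i ≠ j ∧
      sSup (chebyAbs x '' nodeInterval x i) < sSup (chebyAbs y '' nodeInterval y i) ∧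
      sSup (chebyAbs y '' nodeInterval y j) < sSup (chebyAbs x '' nodeInterval x j) := by
  choose z hz hzmax hzlow hzupp hzcrit using exists_max_nodeInterval hx hx'
  choose w hw hwmax hwlow hwupp hwcrit using exists_max_nodeInterval hy hy'
  obtain ⟨i, hi⟩ := exists_prod_abs_lt_prod_abs hn hxy.symm hwlow hwupp hzlow hzupp
    fun i => hwcrit i _ (hz i)
  obtain ⟨j, hj⟩ := exists_prod_abs_lt_prod_abs hn hxy hzlow hzupp hwlow hwupp
    fun i => hzcrit i _ (hw i)
  rw [← hzmax, ← hwmax] at hi hj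
  exact ⟨i, j, fun h => lt_asymm hi (h ▸ hj), hi, hj⟩
end
end
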